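/- Let w: (0,∞) → ℝ be smooth and compactly supported, and assume for each l ∈ ℤ[i] the bound H(l, X) ≪ X^{1/2+ε} N(l₁)^{1/4} + X^{3/4} N(l₁)^{1/8+ε} for the Gauss-sum average, together with the trivial bound H(l,X) ≪ X. Then the sieved sum H′(l,Q) = Σ′_{n ≡ 1 mod (1+i)³} conj(χ_n(l)) g(n) N(n)^{-1/2} w(N(n)/Q) satisfies H′(l,Q) ≪ Q^{3/4+ε} N(l)^{1/8+ε}. -/

import Mathlib

noncomputable section
open Complex
open scoped ComplexConjugate Classical

/-- `n` is primary: `n ≡ 1 mod (1+i)^3` in `ℤ[i]`. -/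
def IsPrimary (n : GaussianInt) : Prop := (⟨1, 1⟩ : GaussianInt) ^ 3 ∣ n - 1

/-- The additive character `ẽ(z) = exp(2πi (z/(2i) - z̄/(2i)))` on `ℚ(i)`. -/
def echar (z : ℂ) : ℂ :=
  Complex.exp (2 * Real.pi * I * (z / (2 * I) - (conj z) / (2 * I)))

/-- The quartic residue symbol `(a/ϖ)₄` at a Gaussian prime `ϖ`: the unique fourth root of
unity `ζ ∈ {1, -1, i, -i}` with `a^((N(ϖ)-1)/4) ≡ ζ (mod ϖ)`, or `0` if `ϖ ∣ a`. -/
def quarticSymbolPrime (a ϖ : GaussianInt) : GaussianInt :=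
  if ϖ ∣ a then 0
  else if h : ∃ ζ : GaussianInt,
      ζ ∈ ({1, -1, ⟨0, 1⟩, ⟨0, -1⟩} : Set GaussianInt) ∧
      ϖ ∣ a ^ (((Zsqrtd.norm ϖ).natAbs - 1) / 4) - ζ
    then h.choose else 0

/-- The quartic residue symbol `(a/n)₄` for odd `n ∈ ℤ[i]`, extended multiplicatively from
Gaussian primes, with value `1` when `n` is a unit. -/
def quarticSymbol (a n : GaussianInt) : GaussianInt :=
  if n = 0 then 0
  else ((UniqueFactorizationMonoid.factors n).map fun ϖ => quarticSymbolPrime a ϖ).prod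

/-- The twisted quartic Gauss sum `g(k,n) = Σ_{x mod n} (x/n)₄ ẽ(kx/n)`. -/
def gaussSumK (k n : GaussianInt) : ℂ :=
  ∑ᶠ x : GaussianInt ⧸ Ideal.span {n},
    GaussianInt.toComplex (quarticSymbol x.out n) *
      echar (GaussianInt.toComplex k * GaussianInt.toComplex x.out / GaussianInt.toComplex n)

/-- The quartic Gauss sum `g(n) = g(1,n)`. -/
def quarticGaussSum (n : GaussianInt) : ℂ := gaussSumK 1 n


/-- The Gauss-sum average `H(l, X) = Σ_{n primary} conj((l/n)₄) g(n) N(n)^{-1/2} w(N(n)/X)`. -/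
def Hsum (w : ℝ → ℝ) (l : GaussianInt) (X : ℝ) : ℂ :=
  ∑ᶠ n : GaussianInt,
    if IsPrimary n then
      conj (GaussianInt.toComplex (quarticSymbol l n)) * quarticGaussSum n /
          (Real.sqrt ((Zsqrtd.norm n : ℝ)) : ℂ) * ((w ((Zsqrtd.norm n : ℝ) / X)) : ℂ)
    else 0

/-- The sieved sum `H′(l, Q)`: as `H(l, Q)` but restricted to square-free `n` with no
rational prime divisors. -/
def Hsum' (w : ℝ → ℝ) (l : GaussianInt) (Q : ℝ) : ℂ :=
  ∑ᶠ n : GaussianInt,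
    if IsPrimary n ∧ Squarefree n ∧ ¬∃ p : ℕ, p.Prime ∧ (p : GaussianInt) ∣ n then
      conj (GaussianInt.toComplex (quarticSymbol l n)) * quarticGaussSum n /
          (Real.sqrt ((Zsqrtd.norm n : ℝ)) : ℂ) * ((w ((Zsqrtd.norm n : ℝ) / Q)) : ℂ)
    else 0

theorem isPrimary_iff (n : GaussianInt) : IsPrimary n ↔ 2 ∣ n.im ∧ 4 ∣ n.re - 1 + n.im := by
  have h3 : (⟨1, 1⟩ : GaussianInt) ^ 3 = ⟨-2, 2⟩ := by
    simp [pow_succ, Zsqrtd.ext_iff]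
  unfold IsPrimary
  rw [h3]
  constructor
  · rintro ⟨⟨x, y⟩, h⟩
    have h1 := congrArg Zsqrtd.re h
    have h2 := congrArg Zsqrtd.im h
    simp at h1 h2
    omega
  · rintro ⟨⟨b, hb⟩, ⟨c, hc⟩⟩
    refine ⟨⟨b - c, -c⟩, ?_⟩
    rw [Zsqrtd.ext_iff]
    simp
    omega

theorem norm_def' (n : GaussianInt) : n.norm = n.re * n.re + n.im * n.im := by
  rw [Zsqrtd.norm_def]; ring

theorem odd_norm_iff (n : GaussianInt) : Odd n.norm ↔ Odd (n.re + n.im) := by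
  rw [norm_def']
  simp only [Int.odd_add, Int.odd_mul, Int.even_mul]
  tauto

theorem IsPrimary.odd {n : GaussianInt} (h : IsPrimary n) : Odd n.norm := by
  rw [isPrimary_iff] at h
  rw [odd_norm_iff, Int.odd_iff]
  omega

theorem IsPrimary.mul {m n : GaussianInt} (hm : IsPrimary m) (hn : IsPrimary n) :
    IsPrimary (m * n) := by
  unfold IsPrimary at *
  have : m * n - 1 = m * (n - 1) + (m - 1) := by ring
  rw [this]
  exact dvd_add (hn.mul_left _) hm

theorem IsPrimary.ne_zero {n : GaussianInt} (h : IsPrimary n) : n ≠ 0 := by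
  rintro rfl
  have := h.odd
  simp [Zsqrtd.norm_def] at this

theorem isPrimary_of_mul {m n : GaussianInt} (hm : IsPrimary m) (h : IsPrimary (m * n)) :
    IsPrimary n := by
  rw [isPrimary_iff] at *
  obtain ⟨⟨b, hb⟩, ⟨c, hc⟩⟩ := hm
  have ha : m.re = 4 * c + 1 - 2 * b := by omega
  simp only [Zsqrtd.re_mul, Zsqrtd.im_mul, hb, ha] at h
  obtain ⟨⟨d, hd⟩, ⟨e, he⟩⟩ := h
  have h1 : 2 ∣ n.im := ⟨d - (2 * c - b) * n.im - b * n.re, by linarith⟩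
  obtain ⟨f, hf⟩ := h1
  refine ⟨⟨f, hf⟩, ?_⟩
  rw [hf] at he ⊢
  exact ⟨e - c * n.re + b * f - 2 * c * f + b * f, by linarith⟩

theorem exists_isPrimary_mul_unit {n : GaussianInt} (h : Odd n.norm) :
    ∃ u : GaussianInt, IsUnit u ∧ IsPrimary (u * n) := by
  rw [odd_norm_iff, Int.odd_iff] at h
  have hi : IsUnit (⟨0, 1⟩ : GaussianInt) :=
    IsUnit.of_mul_eq_one ⟨0, -1⟩ (by simp [Zsqrtd.ext_iff])
  have key : IsPrimary (1 * n) ∨ IsPrimary (-1 * n) ∨ IsPrimary (⟨0, 1⟩ * n) ∨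
      IsPrimary (-⟨0, 1⟩ * n) := by
    simp only [isPrimary_iff, Zsqrtd.re_mul, Zsqrtd.im_mul, Zsqrtd.re_neg, Zsqrtd.im_neg,
      Zsqrtd.re_one, Zsqrtd.im_one]
    omega
  rcases key with h | h | h | h
  exacts [⟨_, isUnit_one, h⟩, ⟨_, isUnit_one.neg, h⟩, ⟨_, hi, h⟩, ⟨_, hi.neg, h⟩]

theorem isUnit_iff_norm_eq_one {u : GaussianInt} : IsUnit u ↔ u.norm = 1 := by
  rw [Zsqrtd.isUnit_iff_norm_isUnit, Int.isUnit_iff]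
  have := GaussianInt.norm_nonneg u
  omega

theorem isPrimary_unit_eq_one {u : GaussianInt} (hu : IsUnit u) (h : IsPrimary u) : u = 1 := by
  rw [isUnit_iff_norm_eq_one, norm_def'] at hu
  rw [isPrimary_iff] at h
  have h1 : u.re ≤ 1 := by nlinarith [sq_nonneg u.im]
  have h2 : -1 ≤ u.re := by nlinarith [sq_nonneg u.im]
  have h3 : u.im ≤ 1 := by nlinarith [sq_nonneg u.re]
  have h4 : -1 ≤ u.im := by nlinarith [sq_nonneg u.re]
  rw [Zsqrtd.ext_iff]
  simp
  omega

/-- The basis `1, i` of `ℤ[i]` over `ℤ`. -/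
def gaussianBasis : Module.Basis (Fin 2) ℤ GaussianInt :=
  Module.Basis.ofEquivFun
    { toFun := fun z => ![z.re, z.im]
      invFun := fun v => ⟨v 0, v 1⟩
      map_add' := fun x y => by ext i; fin_cases i <;> simp
      map_smul' := fun c x => by ext i; fin_cases i <;> simp
      left_inv := fun x => by simp
      right_inv := fun v => by ext i; fin_cases i <;> simp }

instance : Module.Free ℤ GaussianInt := Module.Free.of_basis gaussianBasis
instance : Module.Finite ℤ GaussianInt := Module.Finite.of_basis gaussianBasis

theorem algebraNorm_eq (n : GaussianInt) : Algebra.norm ℤ n = n.norm := by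
  rw [Algebra.norm_eq_matrix_det gaussianBasis, Matrix.det_fin_two]
  simp [Algebra.leftMulMatrix_eq_repr_mul, gaussianBasis, norm_def']

theorem card_quotient (n : GaussianInt) :
    Nat.card (GaussianInt ⧸ Ideal.span {n}) = n.norm.natAbs := by
  rw [← algebraNorm_eq, ← Ideal.absNorm_span_singleton]
  rfl

theorem finite_quotient {n : GaussianInt} (hn : n ≠ 0) :
    Finite (GaussianInt ⧸ Ideal.span {n}) := by
  apply Nat.finite_of_card_ne_zero
  rw [card_quotient]
  simpa [GaussianInt.norm_eq_zero] using hn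

theorem isUnit_iff_mem {ζ : GaussianInt} :
    ζ ∈ ({1, -1, ⟨0, 1⟩, ⟨0, -1⟩} : Set GaussianInt) ↔ IsUnit ζ := by
  rw [isUnit_iff_norm_eq_one, norm_def']
  simp only [Set.mem_insert_iff, Set.mem_singleton_iff, Zsqrtd.ext_iff, Zsqrtd.re_one,
    Zsqrtd.im_one, Zsqrtd.re_neg, Zsqrtd.im_neg]
  constructor
  · rintro (⟨h, h'⟩ | ⟨h, h'⟩ | ⟨h, h'⟩ | ⟨h, h'⟩) <;> rw [h, h'] <;> norm_num
  · intro h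
    have h1 : ζ.re ≤ 1 := by nlinarith [sq_nonneg ζ.im]
    have h2 : -1 ≤ ζ.re := by nlinarith [sq_nonneg ζ.im]
    have h3 : ζ.im ≤ 1 := by nlinarith [sq_nonneg ζ.re]
    have h4 : -1 ≤ ζ.im := by nlinarith [sq_nonneg ζ.re]
    have h5 : ζ.re = -1 ∨ ζ.re = 0 ∨ ζ.re = 1 := by omega
    have h6 : ζ.im = -1 ∨ ζ.im = 0 ∨ ζ.im = 1 := by omega
    rcases h5 with h5 | h5 | h5 <;> rcases h6 with h6 | h6 | h6 <;> rw [h5, h6] at h ⊢ <;>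
      first | (norm_num at h; done) | norm_num

theorem norm_dvd_norm {a b : GaussianInt} (h : a ∣ b) : a.norm ∣ b.norm := by
  obtain ⟨c, rfl⟩ := h
  rw [Zsqrtd.norm_mul]
  exact dvd_mul_right _ _

theorem odd_norm_of_dvd {a b : GaussianInt} (h : a ∣ b) (hb : Odd b.norm) : Odd a.norm := by
  obtain ⟨c, rfl⟩ := h
  rw [Zsqrtd.norm_mul, Int.odd_mul] at hb
  exact hb.1

theorem ne_zero_of_odd {a : GaussianInt} (h : Odd a.norm) : a ≠ 0 := by
  rintro rfl
  simp [Zsqrtd.norm_def] at h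

theorem norm_mod_four {a : GaussianInt} (h : Odd a.norm) : a.norm % 4 = 1 := by
  rw [odd_norm_iff] at h
  rw [norm_def']
  obtain ⟨k, hk⟩ := h
  have : a.re * a.re + a.im * a.im = 4 * (k * k + k - k * a.im) + 1 + 2 * (a.im * a.im - a.im) := by
    have : a.re = 2 * k + 1 - a.im := by omega
    rw [this]; ring
  obtain ⟨c, hc⟩ : (2 : ℤ) ∣ a.im * a.im - a.im := by
    have := Int.even_mul_pred_self a.im
    rw [mul_sub_one] at this
    exact this.two_dvd
  rw [hc] at this
  omega

theorem unit_eq_of_dvd_sub {ϖ ζ ξ : GaussianInt} (ho : Odd ϖ.norm) (hu : ¬IsUnit ϖ)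
    (hζ : IsUnit ζ) (hξ : IsUnit ξ) (h : ϖ ∣ ζ - ξ) : ζ = ξ := by
  have h1 := norm_dvd_norm h
  rw [isUnit_iff_norm_eq_one] at hu
  have h3 := GaussianInt.norm_nonneg ϖ
  have h2 : ∀ k : ℕ, k ≤ 2 → ϖ.norm ∣ 2 ^ k → False := by
    intro k _ hk
    have : IsCoprime ϖ.norm (2 ^ k) := by
      apply IsCoprime.pow_right
      rwa [Int.isCoprime_iff_gcd_eq_one, Int.gcd_comm, ← Int.isCoprime_iff_gcd_eq_one,
        Int.isCoprime_two_left]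
    have := this.isUnit_of_dvd' dvd_rfl hk
    rw [Int.isUnit_iff] at this
    omega
  have h21 := h2 1 (by norm_num)
  have h22 := h2 2 (by norm_num)
  norm_num at h21 h22
  rw [← isUnit_iff_mem] at hζ hξ
  by_contra hne
  have : (ζ - ξ).norm = 2 ∨ (ζ - ξ).norm = 4 := by
    simp only [Set.mem_insert_iff, Set.mem_singleton_iff] at hζ hξ
    rcases hζ with rfl | rfl | rfl | rfl <;> rcases hξ with rfl | rfl | rfl | rfl <;>
      first | (exact absurd rfl hne) | (norm_num [norm_def'])
  rcases this with h | h <;> rw [h] at h1 <;> tauto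

theorem five_le_norm {ϖ : GaussianInt} (hϖ : Prime ϖ) (ho : Odd ϖ.norm) : 5 ≤ ϖ.norm := by
  have h1 := norm_mod_four ho
  have h2 := GaussianInt.norm_nonneg ϖ
  have h3 : ϖ.norm ≠ 1 := fun h => hϖ.not_isUnit (isUnit_iff_norm_eq_one.2 h)
  omega

/-- The exponent `(N(ϖ) - 1) / 4` of the quartic residue symbol. -/
abbrev quarticExp (ϖ : GaussianInt) : ℕ := ((Zsqrtd.norm ϖ).natAbs - 1) / 4

theorem four_mul_quarticExp {ϖ : GaussianInt} (ho : Odd ϖ.norm) :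
    4 * quarticExp ϖ = ϖ.norm.natAbs - 1 := by
  have h1 := norm_mod_four ho
  have h2 := GaussianInt.norm_nonneg ϖ
  unfold quarticExp
  omega

theorem quarticExp_pos {ϖ : GaussianInt} (hϖ : Prime ϖ) (ho : Odd ϖ.norm) :
    0 < quarticExp ϖ := by
  have := five_le_norm hϖ ho
  unfold quarticExp
  omega

theorem isMaximal_span {ϖ : GaussianInt} (hϖ : Prime ϖ) :
    (Ideal.span {ϖ} : Ideal GaussianInt).IsMaximal :=
  PrincipalIdealRing.isMaximal_of_irreducible hϖ.irreducible

theorem dvd_pow_sub_one {ϖ a : GaussianInt} (hϖ : Prime ϖ) (ha : ¬ϖ ∣ a) :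
    ϖ ∣ a ^ (ϖ.norm.natAbs - 1) - 1 := by
  have := isMaximal_span hϖ
  let : Field (GaussianInt ⧸ Ideal.span {ϖ}) := Ideal.Quotient.field _
  have := finite_quotient hϖ.ne_zero
  have := Fintype.ofFinite (GaussianInt ⧸ Ideal.span {ϖ})
  rw [← Ideal.mem_span_singleton, ← Ideal.Quotient.eq_zero_iff_mem, map_sub, map_pow, map_one,
    sub_eq_zero, ← card_quotient, Nat.card_eq_fintype_card]
  apply FiniteField.pow_card_sub_one_eq_one
  rwa [Ne, Ideal.Quotient.eq_zero_iff_mem, Ideal.mem_span_singleton]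

theorem exists_unit_dvd {ϖ a : GaussianInt} (hϖ : Prime ϖ) (ho : Odd ϖ.norm) (ha : ¬ϖ ∣ a) :
    ∃ ζ : GaussianInt, IsUnit ζ ∧ ϖ ∣ a ^ quarticExp ϖ - ζ := by
  have h := dvd_pow_sub_one hϖ ha
  rw [← four_mul_quarticExp ho, mul_comm, pow_mul] at h
  set y := a ^ quarticExp ϖ
  have hi : (⟨0, 1⟩ : GaussianInt) * ⟨0, 1⟩ = -1 := by simp [Zsqrtd.ext_iff]
  have hu : IsUnit (⟨0, 1⟩ : GaussianInt) := IsUnit.of_mul_eq_one (-⟨0, 1⟩) (by rw [mul_neg, hi, neg_neg])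
  have h2 : y ^ 4 - 1 = ((y - 1) * (y - -1)) * ((y - ⟨0, 1⟩) * (y - -⟨0, 1⟩)) := by
    linear_combination (y ^ 2 - 1) * hi
  rw [h2] at h
  rcases hϖ.dvd_or_dvd h with h | h <;> rcases hϖ.dvd_or_dvd h with h | h
  exacts [⟨_, isUnit_one, h⟩, ⟨_, isUnit_one.neg, h⟩, ⟨_, hu, h⟩, ⟨_, hu.neg, h⟩]

theorem quarticSymbolPrime_of_dvd {ϖ a : GaussianInt} (h : ϖ ∣ a) : quarticSymbolPrime a ϖ = 0 :=
  if_pos h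

theorem quarticSymbolPrime_spec {ϖ a : GaussianInt} (hϖ : Prime ϖ) (ho : Odd ϖ.norm)
    (ha : ¬ϖ ∣ a) :
    IsUnit (quarticSymbolPrime a ϖ) ∧ ϖ ∣ a ^ quarticExp ϖ - quarticSymbolPrime a ϖ := by
  have h : ∃ ζ : GaussianInt, ζ ∈ ({1, -1, ⟨0, 1⟩, ⟨0, -1⟩} : Set GaussianInt) ∧
      ϖ ∣ a ^ (((Zsqrtd.norm ϖ).natAbs - 1) / 4) - ζ := by
    simpa only [isUnit_iff_mem] using exists_unit_dvd hϖ ho ha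
  rw [quarticSymbolPrime, if_neg ha, dif_pos h]
  exact ⟨isUnit_iff_mem.1 h.choose_spec.1, h.choose_spec.2⟩

theorem quarticSymbolPrime_dvd {ϖ : GaussianInt} (hϖ : Prime ϖ) (ho : Odd ϖ.norm)
    (a : GaussianInt) : ϖ ∣ a ^ quarticExp ϖ - quarticSymbolPrime a ϖ := by
  by_cases ha : ϖ ∣ a
  · rw [quarticSymbolPrime_of_dvd ha, sub_zero]
    exact dvd_pow ha (quarticExp_pos hϖ ho).ne'
  · exact (quarticSymbolPrime_spec hϖ ho ha).2

theorem quarticSymbolPrime_eq {ϖ a ζ : GaussianInt} (hϖ : Prime ϖ) (ho : Odd ϖ.norm)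
    (hζ : IsUnit ζ) (h : ϖ ∣ a ^ quarticExp ϖ - ζ) : quarticSymbolPrime a ϖ = ζ := by
  have ha : ¬ϖ ∣ a := fun ha => hϖ.not_isUnit (isUnit_of_dvd_unit
    ((dvd_sub_right (dvd_pow ha (quarticExp_pos hϖ ho).ne')).1 h) hζ)
  obtain ⟨h1, h2⟩ := quarticSymbolPrime_spec hϖ ho ha
  refine unit_eq_of_dvd_sub ho hϖ.not_isUnit h1 hζ ?_
  have := dvd_sub h h2
  rwa [sub_sub_sub_cancel_left] at this

theorem quarticSymbolPrime_mul {ϖ : GaussianInt} (hϖ : Prime ϖ) (ho : Odd ϖ.norm)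
    (a b : GaussianInt) :
    quarticSymbolPrime (a * b) ϖ = quarticSymbolPrime a ϖ * quarticSymbolPrime b ϖ := by
  by_cases ha : ϖ ∣ a
  · rw [quarticSymbolPrime_of_dvd ha, quarticSymbolPrime_of_dvd (ha.mul_right b), zero_mul]
  by_cases hb : ϖ ∣ b
  · rw [quarticSymbolPrime_of_dvd hb, quarticSymbolPrime_of_dvd (hb.mul_left a), mul_zero]
  obtain ⟨h1, h2⟩ := quarticSymbolPrime_spec hϖ ho ha
  obtain ⟨h3, h4⟩ := quarticSymbolPrime_spec hϖ ho hb
  refine quarticSymbolPrime_eq hϖ ho (h1.mul h3) ?_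
  have := dvd_add (h4.mul_left (a ^ quarticExp ϖ)) (h2.mul_right (quarticSymbolPrime b ϖ))
  convert this using 1
  ring

theorem quarticSymbolPrime_congr {ϖ a b : GaussianInt} (hϖ : Prime ϖ) (ho : Odd ϖ.norm)
    (h : ϖ ∣ a - b) : quarticSymbolPrime a ϖ = quarticSymbolPrime b ϖ := by
  by_cases hb : ϖ ∣ b
  · have ha : ϖ ∣ a := (dvd_iff_dvd_of_dvd_sub h).2 hb
    rw [quarticSymbolPrime_of_dvd ha, quarticSymbolPrime_of_dvd hb]
  · obtain ⟨h3, h4⟩ := quarticSymbolPrime_spec hϖ ho hb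
    refine quarticSymbolPrime_eq hϖ ho h3 ?_
    have := dvd_add (h.trans (sub_dvd_pow_sub_pow a b (quarticExp ϖ))) h4
    rwa [sub_add_sub_cancel] at this

theorem quarticSymbolPrime_one {ϖ : GaussianInt} (hϖ : Prime ϖ) (ho : Odd ϖ.norm) :
    quarticSymbolPrime 1 ϖ = 1 :=
  quarticSymbolPrime_eq hϖ ho isUnit_one (by simp)

theorem star_dvd_star_iff {a b : GaussianInt} : star a ∣ star b ↔ a ∣ b := by
  constructor
  · rintro ⟨c, hc⟩
    exact ⟨star c, by rw [← star_star b, hc, star_mul, star_star, mul_comm]⟩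
  · rintro ⟨c, rfl⟩
    exact ⟨star c, by rw [star_mul, mul_comm]⟩

theorem gaussianNorm_star (a : GaussianInt) : (star a).norm = a.norm := by
  simp [norm_def']

theorem prime_star {ϖ : GaussianInt} (hϖ : Prime ϖ) : Prime (star ϖ) :=
  (MulEquiv.prime_iff (starRingAut (R := GaussianInt))).2 hϖ

theorem quarticSymbolPrime_star {ϖ : GaussianInt} (hϖ : Prime ϖ) (ho : Odd ϖ.norm)
    (a : GaussianInt) :
    quarticSymbolPrime (star a) (star ϖ) = star (quarticSymbolPrime a ϖ) := by
  by_cases ha : ϖ ∣ a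
  · rw [quarticSymbolPrime_of_dvd ha, quarticSymbolPrime_of_dvd (star_dvd_star_iff.2 ha), star_zero]
  · obtain ⟨h1, h2⟩ := quarticSymbolPrime_spec hϖ ho ha
    refine quarticSymbolPrime_eq (prime_star hϖ) (by rwa [gaussianNorm_star]) h1.star ?_
    rw [quarticExp, gaussianNorm_star, ← star_pow, ← star_sub, star_dvd_star_iff]
    exact h2

theorem quarticSymbolPrime_associated {ϖ ρ : GaussianInt} (h : Associated ϖ ρ)
    (a : GaussianInt) : quarticSymbolPrime a ϖ = quarticSymbolPrime a ρ := by
  have h1 : ∀ b, (ϖ ∣ b) = (ρ ∣ b) := fun b => propext h.dvd_iff_dvd_left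
  have h2 : ϖ.norm.natAbs = ρ.norm.natAbs :=
    Nat.dvd_antisymm (Int.natAbs_dvd_natAbs.2 (norm_dvd_norm h.dvd))
      (Int.natAbs_dvd_natAbs.2 (norm_dvd_norm h.symm.dvd))
  simp only [quarticSymbolPrime, h1, h2]

open UniqueFactorizationMonoid in
theorem quarticSymbol_mul_right (a : GaussianInt) {m n : GaussianInt} (hm : m ≠ 0) (hn : n ≠ 0) :
    quarticSymbol a (m * n) = quarticSymbol a m * quarticSymbol a n := by
  rw [quarticSymbol, quarticSymbol, quarticSymbol, if_neg hm, if_neg hn, if_neg (mul_ne_zero hm hn),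
    ← Multiset.prod_add, ← Multiset.map_add]
  congr 1
  rw [← Multiset.rel_eq, Multiset.rel_map]
  exact (factors_mul hm hn).mono fun x _ y _ h => quarticSymbolPrime_associated h a

open UniqueFactorizationMonoid in
theorem quarticSymbol_isUnit (a : GaussianInt) {u : GaussianInt} (hu : IsUnit u) :
    quarticSymbol a u = 1 := by
  rw [quarticSymbol, if_neg hu.ne_zero, (factors_eq_zero hu.ne_zero).2 hu]
  simp

theorem quarticSymbol_one_right (a : GaussianInt) : quarticSymbol a 1 = 1 :=
  quarticSymbol_isUnit a isUnit_one

open UniqueFactorizationMonoid in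
theorem quarticSymbol_prime (a : GaussianInt) {ϖ : GaussianInt} (hϖ : Prime ϖ) :
    quarticSymbol a ϖ = quarticSymbolPrime a ϖ := by
  rw [quarticSymbol, if_neg hϖ.ne_zero]
  obtain ⟨ρ, t, h1, ht, h2⟩ := Multiset.rel_cons_right.1
    (show Multiset.Rel Associated (factors ϖ) (ϖ ::ₘ 0) from
      prime_factors_unique prime_of_factor (by simpa using hϖ)
        (by simpa using factors_prod hϖ.ne_zero))
  rw [h2, Multiset.rel_zero_right.1 ht]
  simpa using quarticSymbolPrime_associated h1 a

theorem odd_norm_mul {m n : GaussianInt} (hm : Odd m.norm) (hn : Odd n.norm) :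
    Odd (m * n).norm := by
  rw [Zsqrtd.norm_mul]
  exact hm.mul hn

/-- Induction on the factorisation of an odd Gaussian integer. -/
@[elab_as_elim]
theorem odd_induction {P : ∀ n : GaussianInt, Odd n.norm → Prop}
    (unit : ∀ (u : GaussianInt) (_ : IsUnit u) (ho : Odd u.norm), P u ho)
    (mul : ∀ (ϖ n : GaussianInt) (_ : Prime ϖ) (ho : Odd ϖ.norm) (hn : Odd n.norm), P n hn →
      P (ϖ * n) (odd_norm_mul ho hn))
    {n : GaussianInt} (hn : Odd n.norm) : P n hn := by
  induction n using UniqueFactorizationMonoid.induction_on_prime with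
  | h₁ => exact absurd rfl (ne_zero_of_odd hn)
  | h₂ u h => exact unit u h hn
  | h₃ n ϖ _ hϖ ih =>
    have h := hn
    rw [Zsqrtd.norm_mul, Int.odd_mul] at h
    exact mul ϖ n hϖ h.1 h.2 (ih h.2)

theorem quarticSymbol_prime_mul (a : GaussianInt) {ϖ n : GaussianInt} (hϖ : Prime ϖ)
    (hn : n ≠ 0) : quarticSymbol a (ϖ * n) = quarticSymbolPrime a ϖ * quarticSymbol a n := by
  rw [quarticSymbol_mul_right a hϖ.ne_zero hn, quarticSymbol_prime a hϖ]

theorem quarticSymbol_mul_left {n : GaussianInt} (hn : Odd n.norm) (a b : GaussianInt) :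
    quarticSymbol (a * b) n = quarticSymbol a n * quarticSymbol b n := by
  induction hn using odd_induction with
  | unit u hu _ => simp [quarticSymbol_isUnit _ hu]
  | mul ϖ n hϖ ho hn ih =>
    have h0 := ne_zero_of_odd hn
    rw [quarticSymbol_prime_mul _ hϖ h0, quarticSymbol_prime_mul _ hϖ h0,
      quarticSymbol_prime_mul _ hϖ h0, ih, quarticSymbolPrime_mul hϖ ho]
    ring

theorem quarticSymbol_one_left {n : GaussianInt} (hn : Odd n.norm) : quarticSymbol 1 n = 1 := by
  induction hn using odd_induction with
  | unit u hu _ => simp [quarticSymbol_isUnit _ hu]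
  | mul ϖ n hϖ ho hn ih =>
    rw [quarticSymbol_prime_mul _ hϖ (ne_zero_of_odd hn), ih, quarticSymbolPrime_one hϖ ho, one_mul]

theorem quarticSymbol_congr_of_prime_dvd {n a b : GaussianInt} (hn : Odd n.norm)
    (h : ∀ ϖ, Prime ϖ → ϖ ∣ n → ϖ ∣ a - b) : quarticSymbol a n = quarticSymbol b n := by
  induction hn using odd_induction with
  | unit u hu _ => simp [quarticSymbol_isUnit _ hu]
  | mul ϖ n hϖ ho hn ih =>
    have h0 := ne_zero_of_odd hn
    rw [quarticSymbol_prime_mul _ hϖ h0, quarticSymbol_prime_mul _ hϖ h0,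
      ih fun ρ hρ hd => h ρ hρ (hd.mul_left _),
      quarticSymbolPrime_congr hϖ ho (h ϖ hϖ (dvd_mul_right _ _))]

theorem quarticSymbol_congr {n a b : GaussianInt} (hn : Odd n.norm) (h : n ∣ a - b) :
    quarticSymbol a n = quarticSymbol b n :=
  quarticSymbol_congr_of_prime_dvd hn fun _ _ hd => hd.trans h

theorem quarticSymbol_eq_zero {n a ϖ : GaussianInt} (hn : n ≠ 0) (hϖ : Prime ϖ) (h : ϖ ∣ n)
    (ha : ϖ ∣ a) : quarticSymbol a n = 0 := by
  obtain ⟨c, rfl⟩ := h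
  rw [quarticSymbol_prime_mul a hϖ (right_ne_zero_of_mul hn), quarticSymbolPrime_of_dvd ha, zero_mul]

theorem isUnit_quarticSymbol {n a : GaussianInt} (hn : Odd n.norm) (h : IsCoprime a n) :
    IsUnit (quarticSymbol a n) := by
  induction hn using odd_induction with
  | unit u hu _ => simp [quarticSymbol_isUnit _ hu]
  | mul ϖ n hϖ ho hn ih =>
    rw [quarticSymbol_prime_mul _ hϖ (ne_zero_of_odd hn)]
    refine (quarticSymbolPrime_spec hϖ ho fun hd => hϖ.not_isUnit ?_).1.mul (ih h.of_mul_right_right)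
    exact h.of_mul_right_left.isUnit_of_dvd' hd dvd_rfl

theorem quarticSymbol_eq_zero_of_not_isCoprime {n a : GaussianInt} (hn : n ≠ 0)
    (h : ¬IsCoprime a n) : quarticSymbol a n = 0 := by
  have : ∃ ϖ, Prime ϖ ∧ ϖ ∣ a ∧ ϖ ∣ n := by
    by_contra! H
    exact h (isCoprime_of_prime_dvd (fun h => hn h.2) fun ϖ hϖ h1 h2 => H ϖ hϖ h1 h2)
  obtain ⟨ϖ, hϖ, h1, h2⟩ := this
  exact quarticSymbol_eq_zero hn hϖ h2 h1

theorem norm_toComplex_of_isUnit {u : GaussianInt} (hu : IsUnit u) :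
    ‖GaussianInt.toComplex u‖ = 1 := by
  rw [isUnit_iff_norm_eq_one] at hu
  rw [← sq_eq_sq₀ (_root_.norm_nonneg _) zero_le_one, ← Complex.normSq_eq_norm_sq,
    ← GaussianInt.intCast_real_norm, hu]
  simp

theorem mul_star_of_isUnit {u : GaussianInt} (hu : IsUnit u) : u * star u = 1 := by
  rw [isUnit_iff_norm_eq_one] at hu
  rw [← Zsqrtd.norm_eq_mul_conj, hu]
  simp

theorem pow_four_of_isUnit {u : GaussianInt} (hu : IsUnit u) : u ^ 4 = 1 := by
  rw [← isUnit_iff_mem] at hu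
  rcases hu with rfl | rfl | rfl | rfl <;> simp [pow_succ, Zsqrtd.ext_iff]

theorem star_sq_of_isUnit {u : GaussianInt} (hu : IsUnit u) : star (u ^ 2) = u ^ 2 := by
  rw [← isUnit_iff_mem] at hu
  rcases hu with rfl | rfl | rfl | rfl <;> simp [pow_succ, Zsqrtd.ext_iff]

theorem norm_quarticSymbol_le {n : GaussianInt} (hn : Odd n.norm) (a : GaussianInt) :
    ‖GaussianInt.toComplex (quarticSymbol a n)‖ ≤ 1 := by
  by_cases h : IsCoprime a n
  · rw [norm_toComplex_of_isUnit (isUnit_quarticSymbol hn h)]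
  · simp [quarticSymbol_eq_zero_of_not_isCoprime (ne_zero_of_odd hn) h]

theorem echar_eq (z : ℂ) : echar z = Complex.exp (2 * Real.pi * I * (z.im : ℂ)) := by
  unfold echar
  congr 1
  have h : z - conj z = 2 * I * (z.im : ℂ) := by
    rw [Complex.sub_conj]; push_cast; ring
  rw [← sub_div, h, mul_div_cancel_left₀ _ (mul_ne_zero two_ne_zero I_ne_zero)]

theorem echar_add (z w : ℂ) : echar (z + w) = echar z * echar w := by
  rw [echar_eq, echar_eq, echar_eq, ← Complex.exp_add, Complex.add_im]
  push_cast
  ring_nf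

theorem echar_eq_one_iff (z : ℂ) : echar z = 1 ↔ ∃ k : ℤ, z.im = k := by
  rw [echar_eq, Complex.exp_eq_one_iff]
  refine exists_congr fun k => ?_
  rw [mul_comm, mul_left_inj' Complex.two_pi_I_ne_zero]
  exact_mod_cast Iff.rfl

theorem echar_toComplex (t : GaussianInt) : echar (GaussianInt.toComplex t) = 1 :=
  (echar_eq_one_iff _).2 ⟨t.im, (GaussianInt.intCast_im t).symm⟩

theorem echar_zero : echar 0 = 1 := by simp [echar]

/-- The summand `(x/n)₄ ẽ(x/n)` of the quartic Gauss sum. -/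
def gaussTerm (n x : GaussianInt) : ℂ :=
  GaussianInt.toComplex (quarticSymbol x n) *
    echar (GaussianInt.toComplex x / GaussianInt.toComplex n)

theorem toComplex_ne_zero {n : GaussianInt} (hn : n ≠ 0) : GaussianInt.toComplex n ≠ 0 := by
  rwa [Ne, GaussianInt.toComplex_eq_zero]

theorem echar_div_congr {n x y : GaussianInt} (hn : n ≠ 0) (h : n ∣ x - y) :
    echar (GaussianInt.toComplex x / GaussianInt.toComplex n) =
      echar (GaussianInt.toComplex y / GaussianInt.toComplex n) := by
  obtain ⟨t, ht⟩ := h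
  have h0 := toComplex_ne_zero hn
  have : GaussianInt.toComplex x / GaussianInt.toComplex n =
      GaussianInt.toComplex y / GaussianInt.toComplex n + GaussianInt.toComplex t := by
    rw [eq_add_of_sub_eq ht, map_add, map_mul]
    field_simp
    ring
  rw [this, echar_add, echar_toComplex, mul_one]

theorem gaussTerm_congr {n x y : GaussianInt} (hn : Odd n.norm) (h : n ∣ x - y) :
    gaussTerm n x = gaussTerm n y := by
  rw [gaussTerm, gaussTerm, quarticSymbol_congr hn h, echar_div_congr (ne_zero_of_odd hn) h]

theorem dvd_out_sub (n x : GaussianInt) :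
    n ∣ (Ideal.Quotient.mk (Ideal.span {n}) x).out - x := by
  rw [← Ideal.mem_span_singleton, ← Ideal.Quotient.eq]
  exact Quotient.out_eq _

theorem quarticGaussSum_eq_finsum (n : GaussianInt) :
    quarticGaussSum n = ∑ᶠ x : GaussianInt ⧸ Ideal.span {n}, gaussTerm n x.out := by
  simp only [quarticGaussSum, gaussSumK, gaussTerm, map_one, one_mul]

theorem quarticGaussSum_eq_sum {ι : Type*} [Fintype ι] {n : GaussianInt} (hn : Odd n.norm)
    (f : ι → GaussianInt)
    (hf : Function.Bijective fun i => Ideal.Quotient.mk (Ideal.span {n}) (f i)) :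
    quarticGaussSum n = ∑ i, gaussTerm n (f i) := by
  rw [quarticGaussSum_eq_finsum, ← finsum_eq_sum_of_fintype]
  refine (finsum_eq_of_bijective _ hf fun i => ?_).symm
  exact (gaussTerm_congr hn (dvd_out_sub n (f i))).symm

theorem quarticGaussSum_eq_sum_out (n : GaussianInt)
    [Fintype (GaussianInt ⧸ Ideal.span {n})] :
    quarticGaussSum n = ∑ x : GaussianInt ⧸ Ideal.span {n}, gaussTerm n x.out := by
  rw [quarticGaussSum_eq_finsum, finsum_eq_sum_of_fintype]

theorem mk_out (n : GaussianInt) (x : GaussianInt ⧸ Ideal.span {n}) :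
    Ideal.Quotient.mk (Ideal.span {n}) x.out = x := Quotient.out_eq x

theorem mk_eq_mk_iff {n x y : GaussianInt} :
    Ideal.Quotient.mk (Ideal.span {n}) x = Ideal.Quotient.mk (Ideal.span {n}) y ↔ n ∣ x - y := by
  rw [Ideal.Quotient.eq, Ideal.mem_span_singleton]

theorem quarticGaussSum_mul {a b : GaussianInt} (ha : Odd a.norm) (hb : Odd b.norm)
    (h : IsCoprime a b) :
    quarticGaussSum (a * b) =
      GaussianInt.toComplex (quarticSymbol b a) * GaussianInt.toComplex (quarticSymbol a b) *
        quarticGaussSum a * quarticGaussSum b := by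
  have ha0 := ne_zero_of_odd ha
  have hb0 := ne_zero_of_odd hb
  have := finite_quotient ha0
  have := finite_quotient hb0
  have := finite_quotient (mul_ne_zero ha0 hb0)
  have := Fintype.ofFinite (GaussianInt ⧸ Ideal.span {a})
  have := Fintype.ofFinite (GaussianInt ⧸ Ideal.span {b})
  have := Fintype.ofFinite (GaussianInt ⧸ Ideal.span {a * b})
  rw [quarticGaussSum_eq_sum (odd_norm_mul ha hb)
    (fun i : (GaussianInt ⧸ Ideal.span {a}) × (GaussianInt ⧸ Ideal.span {b}) =>
      b * i.1.out + a * i.2.out), quarticGaussSum_eq_sum_out, quarticGaussSum_eq_sum_out,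
      mul_assoc, Finset.sum_mul_sum, ← Finset.sum_product', Finset.mul_sum]
  · refine Finset.sum_congr rfl fun i _ => ?_
    have h1 : quarticSymbol (b * i.1.out + a * i.2.out) a = quarticSymbol (b * i.1.out) a :=
      quarticSymbol_congr ha (by simp)
    have h2 : quarticSymbol (b * i.1.out + a * i.2.out) b = quarticSymbol (a * i.2.out) b :=
      quarticSymbol_congr hb (by simp)
    have h3 : GaussianInt.toComplex (b * i.1.out + a * i.2.out) / GaussianInt.toComplex (a * b) =
        GaussianInt.toComplex i.1.out / GaussianInt.toComplex a +
          GaussianInt.toComplex i.2.out / GaussianInt.toComplex b := by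
      have := toComplex_ne_zero ha0
      have := toComplex_ne_zero hb0
      simp only [map_add, map_mul]
      field_simp
    simp only [gaussTerm]
    rw [quarticSymbol_mul_right _ ha0 hb0, h1, h2, h3, echar_add, quarticSymbol_mul_left ha,
      quarticSymbol_mul_left hb]
    simp only [map_mul]
    ring
  · rw [Fintype.bijective_iff_injective_and_card]
    constructor
    · rintro ⟨x, y⟩ ⟨x', y'⟩ hxy
      simp only [mk_eq_mk_iff] at hxy
      rw [Prod.mk.injEq, ← mk_out a x, ← mk_out a x', ← mk_out b y, ← mk_out b y', mk_eq_mk_iff,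
        mk_eq_mk_iff]
      constructor
      · refine h.dvd_of_dvd_mul_left ?_
        have := dvd_sub ((dvd_mul_right a b).trans hxy) (dvd_mul_right a (y.out - y'.out))
        convert this using 1
        ring
      · refine h.symm.dvd_of_dvd_mul_left ?_
        have := dvd_sub ((dvd_mul_left b a).trans hxy) (dvd_mul_right b (x.out - x'.out))
        convert this using 1
        ring
    · rw [Fintype.card_prod, ← Nat.card_eq_fintype_card, ← Nat.card_eq_fintype_card,
        ← Nat.card_eq_fintype_card, card_quotient, card_quotient, card_quotient, Zsqrtd.norm_mul,
        Int.natAbs_mul]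

theorem exists_echar_ne_one {ϖ : GaussianInt} (h0 : ϖ ≠ 0) (hu : ¬IsUnit ϖ) :
    ∃ t : GaussianInt, echar (GaussianInt.toComplex t / GaussianInt.toComplex ϖ) ≠ 1 := by
  by_contra! H
  obtain ⟨b, hb⟩ := (echar_eq_one_iff _).1 (H 1)
  obtain ⟨a, ha⟩ := (echar_eq_one_iff _).1 (H ⟨0, 1⟩)
  have hi : GaussianInt.toComplex (⟨0, 1⟩ : GaussianInt) = I := by
    simp [GaussianInt.toComplex_def₂, Complex.ext_iff]
  rw [hi, div_eq_mul_inv, Complex.I_mul_im] at ha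
  rw [map_one, one_div] at hb
  refine hu (IsUnit.of_mul_eq_one (⟨a, b⟩ : GaussianInt) (GaussianInt.toComplex_injective ?_))
  have h : GaussianInt.toComplex (⟨a, b⟩ : GaussianInt) = (GaussianInt.toComplex ϖ)⁻¹ := by
    rw [GaussianInt.toComplex_def₂]
    exact Complex.ext ha.symm hb.symm
  rw [map_mul, map_one, h, mul_inv_cancel₀ (toComplex_ne_zero h0)]

theorem quarticGaussSum_eq_zero {n : GaussianInt} (hn : Odd n.norm) (h : ¬Squarefree n) :
    quarticGaussSum n = 0 := by
  have h0 := ne_zero_of_odd hn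
  obtain ⟨ϖ, hϖ, m, hm⟩ : ∃ ϖ, Prime ϖ ∧ ϖ * ϖ ∣ n := by
    by_contra! H
    exact h ((squarefree_iff_irreducible_sq_not_dvd_of_ne_zero h0).2 fun x hx =>
      H x hx.prime)
  obtain ⟨t, ht⟩ := exists_echar_ne_one hϖ.ne_zero hϖ.not_isUnit
  have := finite_quotient h0
  have := Fintype.ofFinite (GaussianInt ⧸ Ideal.span {n})
  have key : quarticGaussSum n = quarticGaussSum n *
      echar (GaussianInt.toComplex t / GaussianInt.toComplex ϖ) := by
    conv_lhs => rw [quarticGaussSum_eq_sum hn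
      (fun x : GaussianInt ⧸ Ideal.span {n} => x.out + ϖ * m * t) (by
        convert (Equiv.addRight (Ideal.Quotient.mk (Ideal.span {n}) (ϖ * m * t))).bijective using 2
        rw [map_add, mk_out]
        rfl)]
    rw [quarticGaussSum_eq_sum_out, Finset.sum_mul]
    refine Finset.sum_congr rfl fun x _ => ?_
    have h1 : quarticSymbol (x.out + ϖ * m * t) n = quarticSymbol x.out n := by
      refine quarticSymbol_congr_of_prime_dvd hn fun ρ hρ hd => ?_
      rw [add_sub_cancel_left]
      refine Dvd.dvd.mul_right ?_ t
      rw [hm, mul_assoc] at hd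
      rcases hρ.dvd_or_dvd hd with h | h
      exacts [h.mul_right m, h]
    have h2 : GaussianInt.toComplex (x.out + ϖ * m * t) / GaussianInt.toComplex n =
        GaussianInt.toComplex x.out / GaussianInt.toComplex n +
          GaussianInt.toComplex t / GaussianInt.toComplex ϖ := by
      have hm0 : m ≠ 0 := by rintro rfl; exact h0 (by rw [hm, mul_zero])
      have := toComplex_ne_zero hϖ.ne_zero
      have := toComplex_ne_zero hm0
      have hn' : GaussianInt.toComplex n = GaussianInt.toComplex ϖ * GaussianInt.toComplex ϖ *
          GaussianInt.toComplex m := by rw [← map_mul, ← map_mul, ← hm]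
      simp only [hn', map_add, map_mul]
      field_simp
    rw [gaussTerm, gaussTerm, h1, h2, echar_add, mul_assoc]
  by_contra hg
  exact ht (mul_left_cancel₀ hg (by rw [← key, mul_one]))

/-- The quartic residue character modulo a Gaussian prime. -/
def quarticChar {ϖ : GaussianInt} (hϖ : Prime ϖ) (ho : Odd ϖ.norm) :
    MulChar (GaussianInt ⧸ Ideal.span {ϖ}) GaussianInt where
  toFun x := quarticSymbolPrime x.out ϖ
  map_one' := by
    rw [← quarticSymbolPrime_one hϖ ho]
    exact quarticSymbolPrime_congr hϖ ho (dvd_out_sub ϖ 1)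
  map_mul' x y := by
    rw [← quarticSymbolPrime_mul hϖ ho]
    refine quarticSymbolPrime_congr hϖ ho ?_
    rw [← mk_eq_mk_iff, map_mul, mk_out, mk_out, mk_out]
  map_nonunit' x hx := by
    have := isMaximal_span hϖ
    let : Field (GaussianInt ⧸ Ideal.span {ϖ}) := Ideal.Quotient.field _
    refine quarticSymbolPrime_of_dvd ?_
    rw [← sub_zero x.out, ← mk_eq_mk_iff, mk_out, map_zero]
    by_contra h0
    exact hx (IsUnit.mk0 x h0)

theorem quarticChar_mk {ϖ : GaussianInt} (hϖ : Prime ϖ) (ho : Odd ϖ.norm) (x : GaussianInt) :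
    quarticChar hϖ ho (Ideal.Quotient.mk _ x) = quarticSymbolPrime x ϖ :=
  quarticSymbolPrime_congr hϖ ho (dvd_out_sub ϖ x)

theorem mk_quarticChar {ϖ : GaussianInt} (hϖ : Prime ϖ) (ho : Odd ϖ.norm)
    (x : GaussianInt ⧸ Ideal.span {ϖ}) :
    Ideal.Quotient.mk (Ideal.span {ϖ}) (quarticChar hϖ ho x) = x ^ quarticExp ϖ := by
  obtain ⟨x, rfl⟩ := Ideal.Quotient.mk_surjective x
  rw [quarticChar_mk, ← map_pow]
  exact (mk_eq_mk_iff.2 (quarticSymbolPrime_dvd hϖ ho x)).symm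

theorem exists_quarticChar_sq_ne_one {ϖ : GaussianInt} (hϖ : Prime ϖ) (ho : Odd ϖ.norm) :
    ∃ x : (GaussianInt ⧸ Ideal.span {ϖ})ˣ, quarticChar hϖ ho x ^ 2 ≠ 1 := by
  have := isMaximal_span hϖ
  let : Field (GaussianInt ⧸ Ideal.span {ϖ}) := Ideal.Quotient.field _
  have := finite_quotient hϖ.ne_zero
  obtain ⟨g, hg⟩ := IsCyclic.exists_generator (α := (GaussianInt ⧸ Ideal.span {ϖ})ˣ)
  have hord := orderOf_eq_card_of_forall_mem_zpowers hg
  rw [Nat.card_units, card_quotient, ← four_mul_quarticExp ho] at hord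
  refine ⟨g, fun h => ?_⟩
  have h1 := congrArg (Ideal.Quotient.mk (Ideal.span {ϖ})) h
  rw [map_pow, mk_quarticChar, map_one, ← pow_mul] at h1
  have h2 : g ^ (quarticExp ϖ * 2) = 1 := Units.ext (by simpa using h1)
  have h3 := Nat.le_of_dvd (by have := quarticExp_pos hϖ ho; omega) (orderOf_dvd_of_pow_eq_one h2)
  have := quarticExp_pos hϖ ho
  omega

/-- The additive character `x ↦ ẽ(x/ϖ)` modulo `ϖ`. -/
def quotientEchar {ϖ : GaussianInt} (h0 : ϖ ≠ 0) : AddChar (GaussianInt ⧸ Ideal.span {ϖ}) ℂ where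
  toFun x := echar (GaussianInt.toComplex x.out / GaussianInt.toComplex ϖ)
  map_zero_eq_one' := by
    rw [← echar_zero, ← zero_div (GaussianInt.toComplex ϖ), ← map_zero GaussianInt.toComplex]
    exact echar_div_congr h0 (dvd_out_sub ϖ 0)
  map_add_eq_mul' x y := by
    rw [← echar_add, ← add_div, ← map_add]
    refine echar_div_congr h0 ?_
    rw [← mk_eq_mk_iff, map_add, mk_out, mk_out, mk_out]

theorem norm_quarticGaussSum_prime {ϖ : GaussianInt} (hϖ : Prime ϖ) (ho : Odd ϖ.norm) :
    ‖quarticGaussSum ϖ‖ = Real.sqrt ϖ.norm := by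
  have := isMaximal_span hϖ
  let : Field (GaussianInt ⧸ Ideal.span {ϖ}) := Ideal.Quotient.field _
  have := finite_quotient hϖ.ne_zero
  have := Fintype.ofFinite (GaussianInt ⧸ Ideal.span {ϖ})
  set χ : MulChar (GaussianInt ⧸ Ideal.span {ϖ}) ℂ :=
    (quarticChar hϖ ho).ringHomComp GaussianInt.toComplex with hχd
  have hg : quarticGaussSum ϖ = gaussSum χ (quotientEchar hϖ.ne_zero) := by
    rw [quarticGaussSum_eq_sum_out]
    refine Finset.sum_congr rfl fun x _ => ?_
    rw [gaussTerm, quarticSymbol_prime _ hϖ]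
    rfl
  have hχ : χ ≠ 1 := by
    obtain ⟨x, hx⟩ := exists_quarticChar_sq_ne_one hϖ ho
    intro h
    apply hx
    have h1 : χ x = 1 := by rw [h, MulChar.one_apply_coe]
    rw [hχd, MulChar.ringHomComp_apply, ← map_one GaussianInt.toComplex,
      GaussianInt.toComplex_inj] at h1
    rw [h1, one_pow]
  have hψ : quotientEchar hϖ.ne_zero ≠ 1 := by
    obtain ⟨t, ht⟩ := exists_echar_ne_one hϖ.ne_zero hϖ.not_isUnit
    intro h
    apply ht
    rw [← echar_div_congr hϖ.ne_zero (dvd_out_sub ϖ t)]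
    exact DFunLike.congr_fun h (Ideal.Quotient.mk _ t)
  have h1 := gaussSum_mul_gaussSum_eq_card hχ (AddChar.IsPrimitive.of_ne_one hψ)
  rw [← star_gaussSum_eq, ← hg, ← starRingEnd_apply, Complex.mul_conj, Complex.normSq_eq_norm_sq,
    ← Nat.card_eq_fintype_card, card_quotient] at h1
  have h2 : ‖quarticGaussSum ϖ‖ ^ 2 = (ϖ.norm.natAbs : ℝ) := by exact_mod_cast h1
  rw [GaussianInt.natCast_natAbs_norm] at h2
  rw [← h2, Real.sqrt_sq (_root_.norm_nonneg _)]

theorem norm_quarticGaussSum_le {n : GaussianInt} (hn : Odd n.norm) :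
    ‖quarticGaussSum n‖ ≤ Real.sqrt n.norm := by
  induction hn using odd_induction with
  | unit u hu ho =>
    have : Subsingleton (GaussianInt ⧸ Ideal.span {u}) := by
      rw [Ideal.Quotient.subsingleton_iff, Ideal.span_singleton_eq_top]
      exact hu
    have := Fintype.ofFinite (GaussianInt ⧸ Ideal.span {u})
    rw [quarticGaussSum_eq_sum_out, isUnit_iff_norm_eq_one.1 hu, Fintype.sum_subsingleton _ 0,
      gaussTerm, norm_mul, echar_eq, mul_right_comm, Complex.norm_exp]
    simpa using norm_quarticSymbol_le ho _
  | mul ϖ n hϖ ho hn ih =>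
    by_cases hd : ϖ ∣ n
    · rw [quarticGaussSum_eq_zero (odd_norm_mul ho hn) fun h => hϖ.not_isUnit
        (h ϖ (mul_dvd_mul_left ϖ hd)), norm_zero]
      exact Real.sqrt_nonneg _
    · rw [quarticGaussSum_mul ho hn ((Prime.coprime_iff_not_dvd hϖ).2 hd), Zsqrtd.norm_mul,
        Int.cast_mul, Real.sqrt_mul (by exact_mod_cast GaussianInt.norm_nonneg ϖ), norm_mul, norm_mul,
        norm_mul, norm_quarticGaussSum_prime hϖ ho]
      have h1 := norm_quarticSymbol_le ho n
      have h2 := norm_quarticSymbol_le hn ϖ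
      calc _ ≤ 1 * 1 * Real.sqrt ϖ.norm * Real.sqrt n.norm := by gcongr
        _ = _ := by ring

theorem dvd_iff_mk_eq_zero {n x : GaussianInt} :
    n ∣ x ↔ Ideal.Quotient.mk (Ideal.span {n}) x = 0 := by
  rw [Ideal.Quotient.eq_zero_iff_mem, Ideal.mem_span_singleton]

theorem quarticChar_pow_four {ϖ : GaussianInt} (hϖ : Prime ϖ) (ho : Odd ϖ.norm) :
    quarticChar hϖ ho ^ 4 = 1 := by
  refine MulChar.ext fun x => ?_
  rw [MulChar.pow_apply_coe, MulChar.one_apply_coe]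
  exact pow_four_of_isUnit (x.isUnit.map (quarticChar hϖ ho))

theorem isPrimitiveRoot_gaussianI : IsPrimitiveRoot (⟨0, 1⟩ : GaussianInt) 4 := by
  rw [IsPrimitiveRoot.iff (by norm_num)]
  refine ⟨by simp [pow_succ, Zsqrtd.ext_iff], fun l h1 h2 => ?_⟩
  interval_cases l <;> simp [pow_succ, Zsqrtd.ext_iff]

theorem ringHomComp_sq_ne_one {ϖ : GaussianInt} (hϖ : Prime ϖ) (ho : Odd ϖ.norm)
    {L : Type*} [Field L] (φ : GaussianInt →+* L)
    (hφ : ∀ u : GaussianInt, IsUnit u → φ u = 1 → u = 1) :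
    (quarticChar hϖ ho).ringHomComp φ * (quarticChar hϖ ho).ringHomComp φ ≠ 1 := by
  obtain ⟨x, hx⟩ := exists_quarticChar_sq_ne_one hϖ ho
  intro h
  have h1 := DFunLike.congr_fun h (x : GaussianInt ⧸ Ideal.span {ϖ})
  rw [MulChar.mul_apply, MulChar.ringHomComp_apply, ← map_mul, MulChar.one_apply_coe,
    ← pow_two] at h1
  exact hx (hφ _ ((x.isUnit.map (quarticChar hϖ ho)).pow 2) h1)

section Jacobi

variable {ϖ : GaussianInt} (hϖ : Prime ϖ) (ho : Odd ϖ.norm)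
  [Fintype (GaussianInt ⧸ Ideal.span {ϖ})]

theorem fintypeCard_quotient : Fintype.card (GaussianInt ⧸ Ideal.span {ϖ}) = ϖ.norm.natAbs := by
  rw [← Nat.card_eq_fintype_card, card_quotient]

theorem dvd_jacobiSum_quarticChar : ϖ ∣ jacobiSum (quarticChar hϖ ho) (quarticChar hϖ ho) := by
  have := isMaximal_span hϖ
  let : Field (GaussianInt ⧸ Ideal.span {ϖ}) := Ideal.Quotient.field _
  rw [dvd_iff_mk_eq_zero, jacobiSum, map_sum]
  simp only [map_mul, mk_quarticChar]
  set e := quarticExp ϖ with he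
  let f : Polynomial (GaussianInt ⧸ Ideal.span {ϖ}) := Polynomial.X ^ e * (1 - Polynomial.X) ^ e
  have hf : ∀ x, x ^ e * (1 - x) ^ e = f.eval x := by intro x; simp [f]
  have hdeg : f.natDegree < Fintype.card (GaussianInt ⧸ Ideal.span {ϖ}) - 1 := by
    have h1 : f.natDegree ≤ e + e := by
      refine Polynomial.natDegree_mul_le.trans (add_le_add (Polynomial.natDegree_X_pow_le e) ?_)
      refine Polynomial.natDegree_pow_le.trans ?_
      have : (1 - Polynomial.X : Polynomial (GaussianInt ⧸ Ideal.span {ϖ})).natDegree ≤ 1 :=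
        (Polynomial.natDegree_sub_le _ _).trans (by simp)
      exact (Nat.mul_le_mul_left e this).trans (by simp)
    have h2 := quarticExp_pos hϖ ho
    rw [fintypeCard_quotient, ← four_mul_quarticExp ho]
    omega
  simp only [hf, Polynomial.eval_eq_sum_range]
  rw [Finset.sum_comm]
  refine Finset.sum_eq_zero fun i hi => ?_
  rw [← Finset.mul_sum, FiniteField.sum_pow_lt_card_sub_one, mul_zero]
  have := Finset.mem_range.1 hi
  omega

theorem norm_jacobiSum_quarticChar :
    (jacobiSum (quarticChar hϖ ho) (quarticChar hϖ ho)).norm = ϖ.norm := by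
  have := isMaximal_span hϖ
  let : Field (GaussianInt ⧸ Ideal.span {ϖ}) := Ideal.Quotient.field _
  have hinj : ∀ u : GaussianInt, IsUnit u → GaussianInt.toComplex u = 1 → u = 1 := by
    intro u _ h
    rwa [← map_one GaussianInt.toComplex, GaussianInt.toComplex_inj] at h
  have hsq := ringHomComp_sq_ne_one hϖ ho GaussianInt.toComplex hinj
  have hne : (quarticChar hϖ ho).ringHomComp GaussianInt.toComplex ≠ 1 := by
    intro h
    exact hsq (by rw [h, one_mul])
  have hchar : ringChar ℂ ≠ ringChar (GaussianInt ⧸ Ideal.span {ϖ}) := by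
    rw [ringChar.eq_zero]
    exact (CharP.ringChar_ne_zero_of_finite _).symm
  have h := jacobiSum_mul_jacobiSum_inv hchar hne hne hsq
  have hstar : jacobiSum ((quarticChar hϖ ho).ringHomComp GaussianInt.toComplex)⁻¹
      ((quarticChar hϖ ho).ringHomComp GaussianInt.toComplex)⁻¹ =
      conj (jacobiSum ((quarticChar hϖ ho).ringHomComp GaussianInt.toComplex)
        ((quarticChar hϖ ho).ringHomComp GaussianInt.toComplex)) := by
    simp only [jacobiSum, map_sum, map_mul, starRingEnd_apply, MulChar.star_apply']
  rw [hstar, jacobiSum_ringHomComp, Complex.mul_conj, ← GaussianInt.intCast_complex_norm,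
    fintypeCard_quotient, GaussianInt.natCast_natAbs_norm] at h
  exact_mod_cast h

theorem jacobiSum_quarticChar_sq (hp : IsPrimary ϖ) :
    jacobiSum (quarticChar hϖ ho) (quarticChar hϖ ho) ^ 2 = ϖ ^ 2 := by
  have := isMaximal_span hϖ
  let : Field (GaussianInt ⧸ Ideal.span {ϖ}) := Ideal.Quotient.field _
  obtain ⟨c, hc⟩ := dvd_jacobiSum_quarticChar hϖ ho
  have hn := norm_jacobiSum_quarticChar hϖ ho
  rw [hc, Zsqrtd.norm_mul] at hn
  have hcu : IsUnit c := by
    rw [isUnit_iff_norm_eq_one]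
    exact mul_left_cancel₀ (GaussianInt.norm_pos.2 hϖ.ne_zero).ne' (by rw [hn, mul_one])
  obtain ⟨z, -, hz⟩ := exists_jacobiSum_eq_neg_one_add (n := 4) (by norm_num)
    (quarticChar_pow_four hϖ ho) (quarticChar_pow_four hϖ ho)
    (by rw [fintypeCard_quotient, ← four_mul_quarticExp ho]; exact dvd_mul_right _ _)
    isPrimitiveRoot_gaussianI
  have hz2 : ((⟨0, 1⟩ : GaussianInt) - 1) ^ 2 = ⟨0, -2⟩ := by
    simp [pow_succ, Zsqrtd.ext_iff]
  rw [hc, hz2] at hz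
  have hc1 : c = 1 ∨ c = -1 := by
    rw [isPrimary_iff] at hp
    have h1 := congrArg Zsqrtd.im hz
    rw [← isUnit_iff_mem] at hcu
    rcases hcu with rfl | rfl | rfl | rfl
    · exact Or.inl rfl
    · exact Or.inr rfl
    · simp at h1; omega
    · simp at h1; omega
  rcases hc1 with rfl | rfl <;> rw [hc] <;> ring

variable {L : Type*} [Field L] (φ : GaussianInt →+* L)
    (hφ : ∀ u : GaussianInt, IsUnit u → φ u = 1 → u = 1)

include hφ in
theorem gaussSum_quarticChar_pow_four (hp : IsPrimary ϖ)
    {ψ : AddChar (GaussianInt ⧸ Ideal.span {ϖ}) L} (hψ : ψ.IsPrimitive) :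
    gaussSum ((quarticChar hϖ ho).ringHomComp φ) ψ ^ 4 = φ (ϖ ^ 3 * star ϖ) := by
  have := isMaximal_span hϖ
  let : Field (GaussianInt ⧸ Ideal.span {ϖ}) := Ideal.Quotient.field _
  set χ := (quarticChar hϖ ho).ringHomComp φ with hχ
  have hsq := ringHomComp_sq_ne_one hϖ ho φ hφ
  have h4 : ∀ x, IsUnit x → χ x ^ 4 = 1 := fun x hx => by
    rw [hχ, MulChar.ringHomComp_apply, ← map_pow, pow_four_of_isUnit (hx.map _), map_one]
  have hquad : (χ * χ).IsQuadratic := by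
    intro x
    by_cases hx : IsUnit x
    · right
      rw [MulChar.mul_apply]
      refine mul_self_eq_one_iff.1 ?_
      rw [← h4 x hx]
      ring
    · left
      exact MulChar.map_nonunit _ hx
  have h1 := jacobiSum_mul_nontrivial hsq ψ
  have h2 := gaussSum_sq hsq hquad hψ
  have h3 : (χ * χ) (-1) = 1 := by
    rw [MulChar.mul_apply, ← map_mul, neg_one_mul, neg_neg, map_one]
  rw [h3, one_mul, fintypeCard_quotient, GaussianInt.natCast_natAbs_norm] at h2
  have h5 : φ (star ϖ * ϖ) = ((ϖ.norm : ℤ) : L) := by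
    rw [mul_comm, ← Zsqrtd.norm_eq_mul_conj, map_intCast]
  calc gaussSum χ ψ ^ 4 = (gaussSum (χ * χ) ψ * jacobiSum χ χ) ^ 2 := by rw [h1]; ring
    _ = φ (star ϖ * ϖ) * φ (jacobiSum (quarticChar hϖ ho) (quarticChar hϖ ho) ^ 2) := by
      rw [mul_pow, h2, hχ, jacobiSum_ringHomComp, map_pow, h5]
    _ = φ (ϖ ^ 3 * star ϖ) := by
      rw [jacobiSum_quarticChar_sq hϖ ho hp, ← map_mul]
      ring_nf

end Jacobi

theorem exists_field_addChar {p : ℕ} (hp : p.Prime) {ϖ π : GaussianInt} (hϖ : Prime ϖ)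
    (hϖp : ϖ ∣ (p : GaussianInt)) (hπ : Prime π) (hπp : ¬π ∣ (p : GaussianInt)) :
    ∃ (L : Type) (_ : Field L) (φ : GaussianInt →+* L)
      (ψ : AddChar (GaussianInt ⧸ Ideal.span {π}) L),
      CharP L p ∧ (∀ x, φ x = 0 ↔ ϖ ∣ x) ∧ ψ.IsPrimitive := by
  have := isMaximal_span hπ
  have := isMaximal_span hϖ
  have := finite_quotient hπ.ne_zero
  let : Field (GaussianInt ⧸ Ideal.span {π}) := Ideal.Quotient.field _
  let : Field (GaussianInt ⧸ Ideal.span {ϖ}) := Ideal.Quotient.field _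
  have hK : CharP (GaussianInt ⧸ Ideal.span {ϖ}) p := by
    rw [CharP.charP_iff_prime_eq_zero hp, ← map_natCast (Ideal.Quotient.mk (Ideal.span {ϖ})),
      ← dvd_iff_mk_eq_zero]
    exact hϖp
  have hchar : ringChar (GaussianInt ⧸ Ideal.span {ϖ}) ≠
      ringChar (GaussianInt ⧸ Ideal.span {π}) := by
    intro h
    rw [ringChar.eq (GaussianInt ⧸ Ideal.span {ϖ}) p] at h
    apply hπp
    rw [dvd_iff_mk_eq_zero, map_natCast, h]
    exact CharP.cast_eq_zero _ _
  let Ψ := AddChar.FiniteField.primitiveChar (GaussianInt ⧸ Ideal.span {π})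
    (GaussianInt ⧸ Ideal.span {ϖ}) hchar
  refine ⟨CyclotomicField Ψ.n (GaussianInt ⧸ Ideal.span {ϖ}), inferInstance,
    (algebraMap _ _).comp (Ideal.Quotient.mk (Ideal.span {ϖ})), Ψ.char,
    charP_of_injective_algebraMap (algebraMap (GaussianInt ⧸ Ideal.span {ϖ}) _).injective p,
    fun x => ?_, Ψ.prim⟩
  rw [RingHom.comp_apply, map_eq_zero, dvd_iff_mk_eq_zero]

theorem map_eq_one_of_isUnit {L : Type*} [Field L] {φ : GaussianInt →+* L} {ϖ : GaussianInt}
    (hϖ : Prime ϖ) (ho : Odd ϖ.norm) (hφ : ∀ x, φ x = 0 ↔ ϖ ∣ x) (u : GaussianInt)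
    (hu : IsUnit u) (h : φ u = 1) : u = 1 :=
  unit_eq_of_dvd_sub ho hϖ.not_isUnit hu isUnit_one ((hφ _).1 (by rw [map_sub, h, map_one, sub_self]))

theorem not_dvd_of_prime_natCast {p : ℕ} {π : GaussianInt} (hπ : Prime π)
    (hπp : ¬π ∣ (p : GaussianInt)) {ϖ : GaussianInt} (hϖ : Prime ϖ) (hϖp : ϖ ∣ (p : GaussianInt)) :
    ¬ϖ ∣ π ∧ ¬ϖ ∣ star π := by
  have key : ∀ ρ : GaussianInt, Prime ρ → ρ ∣ (p : GaussianInt) → ¬ρ ∣ π := fun ρ hρ hd h =>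
    hπp ((hρ.associated_of_dvd hπ h).symm.dvd.trans hd)
  refine ⟨key ϖ hϖ hϖp, fun h => key (star ϖ) (prime_star hϖ) ?_ ?_⟩
  · rw [← star_dvd_star_iff, star_star, star_natCast]
    exact hϖp
  · rw [← star_dvd_star_iff, star_star]
    exact h

theorem prime_of_norm_eq_prime {p : ℕ} (hp : p.Prime) {ϖ : GaussianInt} (h : ϖ.norm = p) :
    Prime ϖ := by
  refine Irreducible.prime ⟨fun hu => ?_, fun a b hab => ?_⟩
  · rw [isUnit_iff_norm_eq_one, h] at hu
    exact hp.ne_one (by exact_mod_cast hu)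
  · rw [hab, Zsqrtd.norm_mul] at h
    have h1 := congrArg Int.natAbs h
    rw [Int.natAbs_mul, Int.natAbs_natCast] at h1
    rw [← Zsqrtd.norm_eq_one_iff, ← Zsqrtd.norm_eq_one_iff]
    have h2 : IsUnit a.norm.natAbs ∨ IsUnit b.norm.natAbs :=
      Irreducible.isUnit_or_isUnit hp h1.symm
    simpa using h2

theorem gaussSum_quarticChar_ne_zero {L : Type*} [Field L] {φ : GaussianInt →+* L}
    {ϖ π : GaussianInt} (hϖ : Prime ϖ) (hoϖ : Odd ϖ.norm) (hφ : ∀ x, φ x = 0 ↔ ϖ ∣ x)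
    (hπ : Prime π) (ho : Odd π.norm) (hpr : IsPrimary π) (h1 : ¬ϖ ∣ π) (h2 : ¬ϖ ∣ star π)
    [Fintype (GaussianInt ⧸ Ideal.span {π})]
    {ψ : AddChar (GaussianInt ⧸ Ideal.span {π}) L} (hψ : ψ.IsPrimitive) :
    gaussSum ((quarticChar hπ ho).ringHomComp φ) ψ ≠ 0 := by
  intro h
  have h4 := gaussSum_quarticChar_pow_four hπ ho φ (map_eq_one_of_isUnit hϖ hoϖ hφ) hpr hψ
  rw [h, zero_pow (by norm_num)] at h4
  rcases hϖ.dvd_or_dvd ((hφ _).1 h4.symm) with h | h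
  · exact h1 (hϖ.dvd_of_dvd_pow h)
  · exact h2 h

theorem quarticSymbol_natCast_eq_of_one {p : ℕ} (hp : p.Prime) (hp4 : p % 4 = 1) {π : GaussianInt}
    (hπ : Prime π) (hpr : IsPrimary π) (hπp : ¬π ∣ (p : GaussianInt)) :
    quarticSymbol π p = quarticSymbol (p : GaussianInt) π := by
  have := finite_quotient hπ.ne_zero
  have := Fintype.ofFinite (GaussianInt ⧸ Ideal.span {π})
  have : Fact p.Prime := ⟨hp⟩
  obtain ⟨a, b, hab⟩ := Nat.Prime.sq_add_sq (p := p) (by omega)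
  set ϖ : GaussianInt := ⟨a, b⟩ with hϖdef
  have hnorm : ϖ.norm = p := by
    rw [norm_def', ← hab]
    push_cast
    ring
  have hϖ := prime_of_norm_eq_prime hp hnorm
  have hoϖ : Odd ϖ.norm := by
    rw [hnorm, Int.odd_iff]
    omega
  have hfac : (p : GaussianInt) = ϖ * star ϖ := by
    rw [← Zsqrtd.norm_eq_mul_conj, hnorm]
    simp
  have hϖp : ϖ ∣ (p : GaussianInt) := hfac ▸ dvd_mul_right _ _
  have ho := hpr.odd
  obtain ⟨h1, h2⟩ := not_dvd_of_prime_natCast hπ hπp hϖ hϖp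
  obtain ⟨L, _, φ, ψ, hL, hφ, hψ⟩ := exists_field_addChar hp hϖ hϖp hπ hπp
  have hφu := map_eq_one_of_isUnit hϖ hoϖ hφ
  have hg := gaussSum_quarticChar_ne_zero hϖ hoϖ hφ hπ ho hpr h1 h2 hψ
  have hg4 := gaussSum_quarticChar_pow_four hπ ho φ hφu hpr hψ
  set χ := (quarticChar hπ ho).ringHomComp φ with hχ
  have hk : p = 4 * quarticExp ϖ + 1 := by
    rw [four_mul_quarticExp hoϖ, hnorm]
    have := hp.pos
    simp
    omega
  have hχ4 : χ ^ 4 = 1 := by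
    rw [hχ, MulChar.ringHomComp_pow, quarticChar_pow_four, MulChar.ringHomComp_one]
  have hχp : χ ^ p = χ := by
    rw [hk, pow_succ, pow_mul, hχ4, one_pow, one_mul]
  have hpu : IsUnit (p : GaussianInt ⧸ Ideal.span {π}) := by
    have := isMaximal_span hπ
    let : Field (GaussianInt ⧸ Ideal.span {π}) := Ideal.Quotient.field _
    rw [isUnit_iff_ne_zero, ← map_natCast (Ideal.Quotient.mk (Ideal.span {π})), Ne,
      ← dvd_iff_mk_eq_zero]
    exact hπp
  have hfrob := gaussSum_frob p χ ψ
  rw [hχp, AddChar.pow_mulShift] at hfrob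
  have hshift := gaussSum_mulShift χ ψ hpu.unit
  rw [IsUnit.unit_spec, ← hfrob] at hshift
  have hχval : χ (p : GaussianInt ⧸ Ideal.span {π}) = φ (quarticSymbolPrime p π) := by
    rw [hχ, MulChar.ringHomComp_apply, ← map_natCast (Ideal.Quotient.mk (Ideal.span {π})),
      quarticChar_mk]
  have hone : φ (quarticSymbolPrime p π * (π ^ 3 * star π) ^ quarticExp ϖ) = 1 := by
    rw [map_mul, ← hχval, map_pow, ← hg4, ← pow_mul]
    refine mul_right_cancel₀ hg ?_
    rw [one_mul, mul_assoc, ← pow_succ, ← hk, hshift]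
  obtain ⟨hAu, hA⟩ := quarticSymbolPrime_spec hϖ hoϖ h1
  obtain ⟨hBu, hB⟩ := quarticSymbolPrime_spec hϖ hoϖ h2
  obtain ⟨hSu, -⟩ := quarticSymbolPrime_spec hπ ho hπp
  have hmap : ∀ x y : GaussianInt, ϖ ∣ x - y → φ x = φ y := fun x y h => by
    rwa [← hφ, map_sub, sub_eq_zero] at h
  rw [map_mul, mul_pow, ← pow_mul, mul_comm 3, pow_mul, map_mul, map_pow _ _ 3, hmap _ _ hA,
    hmap _ _ hB, ← map_pow, ← map_mul, ← map_mul] at hone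
  have h3 := hφu _ (hSu.mul ((hAu.pow 3).mul hBu)) hone
  have h5 : quarticSymbol π p =
      quarticSymbolPrime π ϖ * star (quarticSymbolPrime (star π) ϖ) := by
    rw [hfac, quarticSymbol_prime_mul _ hϖ (prime_star hϖ).ne_zero,
      quarticSymbol_prime _ (prime_star hϖ), ← quarticSymbolPrime_star hϖ hoϖ, star_star]
  rw [h5, quarticSymbol_prime _ hπ]
  linear_combination (-quarticSymbolPrime π ϖ * star (quarticSymbolPrime (star π) ϖ)) * h3 +
    quarticSymbolPrime p π * quarticSymbolPrime (star π) ϖ * star (quarticSymbolPrime (star π) ϖ) *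
      pow_four_of_isUnit hAu + quarticSymbolPrime p π * mul_star_of_isUnit hBu

theorem prime_natCast {p : ℕ} (hp : p.Prime) (hp4 : p % 4 = 3) : Prime (p : GaussianInt) := by
  have : Fact p.Prime := ⟨hp⟩
  exact GaussianInt.prime_of_nat_prime_of_mod_four_eq_three p hp4

theorem dvd_star_sub_pow {p : ℕ} (hp : p.Prime) (hp4 : p % 4 = 3) (x : GaussianInt) :
    (p : GaussianInt) ∣ star x - x ^ p := by
  have : Fact p.Prime := ⟨hp⟩
  have := isMaximal_span (prime_natCast hp hp4)
  let : Field (GaussianInt ⧸ Ideal.span {(p : GaussianInt)}) := Ideal.Quotient.field _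
  have : CharP (GaussianInt ⧸ Ideal.span {(p : GaussianInt)}) p := by
    refine (CharP.charP_iff_prime_eq_zero hp).2 ?_
    rw [← map_natCast (Ideal.Quotient.mk (Ideal.span {(p : GaussianInt)})), ← dvd_iff_mk_eq_zero]
  have hI : (⟨0, 1⟩ : GaussianInt) ^ p = star ⟨0, 1⟩ := by
    rw [← Nat.div_add_mod p 4, hp4, pow_add, pow_mul, isPrimitiveRoot_gaussianI.pow_eq_one, one_pow]
    simp [pow_succ, Zsqrtd.ext_iff]
  have h : (Ideal.Quotient.mk (Ideal.span {(p : GaussianInt)})).comp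
      (starRingEnd GaussianInt) = (frobenius _ p).comp (Ideal.Quotient.mk _) := by
    refine Zsqrtd.hom_ext _ _ ?_
    rw [RingHom.comp_apply, RingHom.comp_apply, frobenius_def, ← map_pow]
    exact congrArg _ hI.symm
  have := DFunLike.congr_fun h x
  rw [RingHom.comp_apply, RingHom.comp_apply, frobenius_def, ← map_pow] at this
  rw [dvd_iff_mk_eq_zero, map_sub, sub_eq_zero]
  exact this

theorem quarticSymbol_natCast_eq_of_three {p : ℕ} (hp : p.Prime) (hp4 : p % 4 = 3)
    {π : GaussianInt} (hπ : Prime π) (hpr : IsPrimary π) (hπp : ¬π ∣ (p : GaussianInt)) :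
    quarticSymbol π p = quarticSymbol (-p : GaussianInt) π := by
  have := finite_quotient hπ.ne_zero
  have := Fintype.ofFinite (GaussianInt ⧸ Ideal.span {π})
  have : Fact p.Prime := ⟨hp⟩
  have hϖ := prime_natCast hp hp4
  have hnorm : (p : GaussianInt).norm = p ^ 2 := by
    rw [Zsqrtd.norm_natCast, pow_two]
  have hoϖ : Odd (p : GaussianInt).norm := by
    rw [hnorm]
    refine Odd.pow ?_
    rw [Int.odd_iff]
    omega
  have ho := hpr.odd
  obtain ⟨h1, h2⟩ := not_dvd_of_prime_natCast hπ hπp hϖ dvd_rfl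
  obtain ⟨L, _, φ, ψ, hL, hφ, hψ⟩ := exists_field_addChar hp hϖ dvd_rfl hπ hπp
  have hφu := map_eq_one_of_isUnit hϖ hoϖ hφ
  have hg4 := gaussSum_quarticChar_pow_four hπ ho φ hφu hpr hψ
  have hne := ringHomComp_sq_ne_one hπ ho φ hφu
  set χ := (quarticChar hπ ho).ringHomComp φ with hχ
  have hχ1 : χ ≠ 1 := by
    intro h
    exact hne (by rw [h, one_mul])
  have hχ4 : χ ^ 4 = 1 := by
    rw [hχ, MulChar.ringHomComp_pow, quarticChar_pow_four, MulChar.ringHomComp_one]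
  have hχinv : χ ^ 3 = χ⁻¹ := by
    rw [eq_inv_iff_mul_eq_one, ← pow_succ, hχ4]
  have hχp : χ ^ p = χ⁻¹ := by
    rw [← Nat.div_add_mod p 4, hp4, pow_add, pow_mul, hχ4, one_pow, one_mul, hχinv]
  have hmk : ∀ x : GaussianInt, χ (Ideal.Quotient.mk _ x) = φ (quarticSymbolPrime x π) := by
    intro x
    rw [hχ, MulChar.ringHomComp_apply, quarticChar_mk]
  have hpu : IsUnit (p : GaussianInt ⧸ Ideal.span {π}) := by
    have := isMaximal_span hπ
    let : Field (GaussianInt ⧸ Ideal.span {π}) := Ideal.Quotient.field _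
    rw [isUnit_iff_ne_zero, ← map_natCast (Ideal.Quotient.mk (Ideal.span {π})), Ne,
      ← dvd_iff_mk_eq_zero]
    exact hπp
  have hfrob := gaussSum_frob p χ ψ
  rw [hχp, AddChar.pow_mulShift] at hfrob
  have hshift := gaussSum_mulShift χ⁻¹ ψ hpu.unit
  rw [IsUnit.unit_spec, ← hfrob] at hshift
  have hcard : gaussSum χ ψ * gaussSum χ⁻¹ ψ = χ (-1) * φ π.norm := by
    have := isMaximal_span hπ
    let : Field (GaussianInt ⧸ Ideal.span {π}) := Ideal.Quotient.field _
    rw [← mul_gaussSum_inv_eq_gaussSum χ⁻¹ ψ, mul_left_comm,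
      gaussSum_mul_gaussSum_eq_card hχ1 hψ, fintypeCard_quotient, map_intCast,
      MulChar.inv_apply', inv_neg, inv_one, GaussianInt.natCast_natAbs_norm]
  have hpow : gaussSum χ ψ ^ (p + 1) = φ (quarticSymbolPrime (-p) π * π.norm) := by
    rw [map_mul, ← hmk, map_neg, map_natCast,
      neg_eq_neg_one_mul (p : GaussianInt ⧸ Ideal.span {π}), map_mul, mul_comm (χ (-1)),
      mul_assoc, ← hcard, mul_left_comm, ← hshift, pow_succ', ← mul_assoc (χ p)]
    have : χ p * χ⁻¹ p = 1 := by
      rw [← MulChar.mul_apply, mul_inv_cancel, MulChar.one_apply hpu]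
    rw [this, one_mul]
  have hdvd : ((p : ℕ) : GaussianInt) ∣ (π ^ 3 * star π) ^ ((p + 1) / 4) -
      quarticSymbolPrime (-p) π * π.norm := by
    rw [← hφ, map_sub, ← hpow, map_pow, ← hg4, ← pow_mul, sub_eq_zero]
    congr 1
    omega
  obtain ⟨m, hm⟩ : ∃ m, p + 1 = 4 * m := ⟨(p + 1) / 4, by omega⟩
  have hexp : 4 * quarticExp (p : GaussianInt) = p ^ 2 - 1 := by
    rw [four_mul_quarticExp hoϖ, hnorm, Int.natAbs_pow, Int.natAbs_natCast]
  have hexp2 : (3 + p) * m = quarticExp (p : GaussianInt) + (1 + p) := by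
    zify [Nat.one_le_pow 2 p hp.pos] at hexp hm ⊢
    have : (p : ℤ) = 4 * m - 1 := by linarith
    rw [this] at hexp ⊢
    linarith
  rw [hm, Nat.mul_div_cancel_left _ (by norm_num)] at hdvd
  have hnc : ((π.norm : ℤ) : GaussianInt) = π * star π := Zsqrtd.norm_eq_mul_conj π
  have hmap : φ (star π) = φ (π ^ p) := by
    rw [← sub_eq_zero, ← map_sub, hφ]
    exact dvd_star_sub_pow hp hp4 π
  have hres : (p : GaussianInt) ∣ π ^ quarticExp (p : GaussianInt) - quarticSymbolPrime (-p) π := by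
    rw [← hφ, hnc, map_sub, map_pow, map_mul, map_mul, map_mul, hmap, ← map_mul, ← map_mul,
      ← map_pow, ← pow_add, ← pow_mul, hexp2, pow_add, pow_add π 1 p, pow_one, map_mul,
      ← sub_mul] at hdvd
    rw [← hφ, map_sub]
    refine (mul_eq_zero.1 hdvd).resolve_right fun h => h1 ?_
    rw [hφ, ← pow_succ'] at h
    exact hϖ.dvd_of_dvd_pow h
  have hunit : IsUnit (quarticSymbolPrime (-p) π) :=
    (quarticSymbolPrime_spec hπ ho (by rwa [dvd_neg])).1
  rw [quarticSymbol_prime _ hϖ, quarticSymbol_prime _ hπ, quarticSymbolPrime_eq hϖ hoϖ hunit hres]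

/-- The primary associate `±d` of an odd natural number `d`. -/
def primaryNat (d : ℕ) : GaussianInt := if d % 4 = 1 then d else -d

theorem primaryNat_one : primaryNat 1 = 1 := by simp [primaryNat]

theorem primaryNat_mul {a b : ℕ} (ha : Odd a) (hb : Odd b) :
    primaryNat (a * b) = primaryNat a * primaryNat b := by
  have h1 : a % 4 = 1 ∨ a % 4 = 3 := by have := Nat.odd_iff.1 ha; omega
  have h2 : b % 4 = 1 ∨ b % 4 = 3 := by have := Nat.odd_iff.1 hb; omega
  rcases h1 with h1 | h1 <;> rcases h2 with h2 | h2 <;> simp [primaryNat, Nat.mul_mod, h1, h2]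

theorem primaryNat_eq_or (d : ℕ) : primaryNat d = d ∨ primaryNat d = -d := by
  unfold primaryNat
  split_ifs <;> simp

theorem primaryNat_associated (d : ℕ) : Associated (primaryNat d) d := by
  rcases primaryNat_eq_or d with h | h <;> rw [h]
  exact (Associated.refl _).neg_left

theorem isPrimary_primaryNat {d : ℕ} (hd : Odd d) : IsPrimary (primaryNat d) := by
  have h1 : d % 4 = 1 ∨ d % 4 = 3 := by have := Nat.odd_iff.1 hd; omega
  rw [isPrimary_iff]
  rcases h1 with h1 | h1 <;> simp [primaryNat, h1] <;> omega

theorem norm_primaryNat (d : ℕ) : (primaryNat d).norm = (d : ℤ) ^ 2 := by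
  rcases primaryNat_eq_or d with h | h <;> rw [h] <;> simp [norm_def', pow_two]

theorem quarticSymbol_neg_right (a : GaussianInt) {n : GaussianInt} (hn : n ≠ 0) :
    quarticSymbol a (-n) = quarticSymbol a n := by
  rw [neg_eq_neg_one_mul, quarticSymbol_mul_right a (by simp) hn,
    quarticSymbol_isUnit a isUnit_one.neg, one_mul]

theorem quarticSymbol_prime_primaryNat {p : ℕ} (hp : p.Prime) (ho : Odd p) {π : GaussianInt}
    (hπ : Prime π) (hpr : IsPrimary π) :
    quarticSymbol π (primaryNat p) = quarticSymbol (primaryNat p) π := by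
  by_cases hπp : π ∣ (p : GaussianInt)
  · have hd : π ∣ primaryNat p := hπp.trans (primaryNat_associated p).symm.dvd
    rw [quarticSymbol_eq_zero hpr.ne_zero hπ dvd_rfl hd,
      quarticSymbol_eq_zero (isPrimary_primaryNat ho).ne_zero hπ hd dvd_rfl]
  · have h1 : p % 4 = 1 ∨ p % 4 = 3 := by have := Nat.odd_iff.1 ho; omega
    rcases h1 with h1 | h1
    · simpa [primaryNat, h1] using quarticSymbol_natCast_eq_of_one hp h1 hπ hpr hπp
    · rw [primaryNat, if_neg (by omega),
        quarticSymbol_neg_right _ (prime_natCast hp h1).ne_zero]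
      exact quarticSymbol_natCast_eq_of_three hp h1 hπ hpr hπp

theorem quarticSymbol_primaryNat_of_prime {p : ℕ} (hp : p.Prime) (hpo : Odd p) {n : GaussianInt}
    (hn : IsPrimary n) : quarticSymbol n (primaryNat p) = quarticSymbol (primaryNat p) n := by
  have hpp := isPrimary_primaryNat hpo
  suffices h : ∀ m, Associated m n → IsPrimary m →
      quarticSymbol m (primaryNat p) = quarticSymbol (primaryNat p) m from h n (.refl n) hn
  have ho := hn.odd
  clear hn
  induction ho using odd_induction with
  | unit u hu _ =>
    intro m hm hmp
    rw [isPrimary_unit_eq_one ((Associated.isUnit_iff hm).2 hu) hmp, quarticSymbol_one_right,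
      quarticSymbol_one_left hpp.odd]
  | mul ϖ n hϖ ho hn ih =>
    intro m hm hmp
    obtain ⟨u, hu, hup⟩ := exists_isPrimary_mul_unit ho
    have hass : Associated (u * ϖ) ϖ := associated_unit_mul_left ϖ u hu
    obtain ⟨c, rfl⟩ : u * ϖ ∣ m := hass.dvd.trans ((dvd_mul_right ϖ n).trans hm.symm.dvd)
    have hcp := isPrimary_of_mul hup hmp
    have hcn : Associated c n := hm.of_mul_left hass hup.ne_zero
    rw [quarticSymbol_mul_left hpp.odd, quarticSymbol_mul_right _ hup.ne_zero hcp.ne_zero,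
      ih c hcn hcp, quarticSymbol_prime_primaryNat hp hpo (hass.symm.prime hϖ) hup]

theorem quarticSymbol_primaryNat {d : ℕ} (hd : Odd d) {n : GaussianInt} (hn : IsPrimary n) :
    quarticSymbol n (primaryNat d) = quarticSymbol (primaryNat d) n := by
  induction d using induction_on_primes with
  | zero => simp at hd
  | one => rw [primaryNat_one, quarticSymbol_one_right, quarticSymbol_one_left hn.odd]
  | prime_mul p a hp ih =>
    obtain ⟨h1, h2⟩ := Nat.odd_mul.1 hd
    rw [primaryNat_mul h1 h2, quarticSymbol_mul_right _ (isPrimary_primaryNat h1).ne_zero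
      (isPrimary_primaryNat h2).ne_zero, quarticSymbol_mul_left hn.odd, ih h2,
      quarticSymbol_primaryNat_of_prime hp h1 hn]

theorem natCast_sq_eq (d : ℕ) : (d : GaussianInt) ^ 2 = primaryNat d * primaryNat d := by
  rcases primaryNat_eq_or d with h | h <;> rw [h] <;> ring

theorem quarticSymbol_mul_quarticGaussSum_primaryNat_mul {d : ℕ} (hd : Odd d) {m : GaussianInt}
    (hm : IsPrimary m) (l : GaussianInt) :
    conj (GaussianInt.toComplex (quarticSymbol l (primaryNat d * m))) *
        quarticGaussSum (primaryNat d * m) =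
      conj (GaussianInt.toComplex (quarticSymbol l (primaryNat d))) *
          quarticGaussSum (primaryNat d) *
        (conj (GaussianInt.toComplex (quarticSymbol (l * (d : GaussianInt) ^ 2) m)) *
          quarticGaussSum m) := by
  have hD := isPrimary_primaryNat hd
  rw [natCast_sq_eq, quarticSymbol_mul_left hm.odd, quarticSymbol_mul_left hm.odd,
    quarticSymbol_mul_right l hD.ne_zero hm.ne_zero]
  by_cases hc : IsCoprime (primaryNat d) m
  · have hu := isUnit_quarticSymbol hm.odd hc
    have hstar : conj (GaussianInt.toComplex (quarticSymbol (primaryNat d) m ^ 2)) =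
        GaussianInt.toComplex (quarticSymbol (primaryNat d) m ^ 2) := by
      rw [← GaussianInt.toComplex_star, star_sq_of_isUnit hu]
    rw [quarticGaussSum_mul hD.odd hm.odd hc, quarticSymbol_primaryNat hd hm,
      ← pow_two (quarticSymbol (primaryNat d) m),
      map_mul, map_mul, map_mul, map_mul, hstar, map_pow]
    ring
  · have h0 : ¬Squarefree (primaryNat d * m) := fun h => hc (squarefree_mul_iff.1 h).1.isCoprime
    rw [quarticGaussSum_eq_zero (hD.mul hm).odd h0,
      quarticSymbol_eq_zero_of_not_isCoprime hm.ne_zero hc]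
    simp

/-- The summand of `Hsum`. -/
def HsumTerm (w : ℝ → ℝ) (l : GaussianInt) (X : ℝ) (n : GaussianInt) : ℂ :=
  if IsPrimary n then
    conj (GaussianInt.toComplex (quarticSymbol l n)) * quarticGaussSum n /
      (Real.sqrt ((Zsqrtd.norm n : ℝ)) : ℂ) * ((w ((Zsqrtd.norm n : ℝ) / X)) : ℂ)
  else 0

theorem Hsum_eq (w : ℝ → ℝ) (l : GaussianInt) (X : ℝ) :
    Hsum w l X = ∑ᶠ n, HsumTerm w l X n := rfl

theorem HsumTerm_primaryNat_mul (w : ℝ → ℝ) (l : GaussianInt) (Q : ℝ) {d : ℕ} (hd : Odd d)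
    (m : GaussianInt) :
    HsumTerm w l Q (primaryNat d * m) =
      conj (GaussianInt.toComplex (quarticSymbol l (primaryNat d))) *
          quarticGaussSum (primaryNat d) / d *
        HsumTerm w (l * (d : GaussianInt) ^ 2) (Q / (d : ℝ) ^ 2) m := by
  have hD := isPrimary_primaryNat hd
  by_cases hm : IsPrimary m
  · have hn : ((primaryNat d * m).norm : ℝ) = (d : ℝ) ^ 2 * m.norm := by
      rw [Zsqrtd.norm_mul, norm_primaryNat]
      push_cast
      ring
    rw [HsumTerm, HsumTerm, if_pos hm, if_pos (hD.mul hm), hn,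
      Real.sqrt_mul (sq_nonneg _), Real.sqrt_sq d.cast_nonneg,
      quarticSymbol_mul_quarticGaussSum_primaryNat_mul hd hm, div_div_eq_mul_div,
      mul_comm _ (m.norm : ℝ)]
    push_cast
    ring
  · rw [HsumTerm, HsumTerm, if_neg hm, if_neg fun h => hm (isPrimary_of_mul hD h), mul_zero]

theorem natCast_dvd_iff (d : ℕ) (n : GaussianInt) :
    (d : GaussianInt) ∣ n ↔ d ∣ Int.gcd n.re n.im := by
  rw [← Int.cast_natCast, Zsqrtd.intCast_dvd, Int.dvd_gcd_iff, Int.natCast_dvd, Int.natCast_dvd]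

open ArithmeticFunction in
theorem sum_moebius_natCast_dvd {n : GaussianInt} {K : ℕ} (hn : n ≠ 0)
    (hK : Int.gcd n.re n.im ≤ K) :
    ∑ d ∈ Finset.Icc 1 K, (if (d : GaussianInt) ∣ n then (moebius d : ℂ) else 0) =
      if ∃ p : ℕ, p.Prime ∧ (p : GaussianInt) ∣ n then 0 else 1 := by
  have h0 : Int.gcd n.re n.im ≠ 0 := by
    rw [Ne, Int.gcd_eq_zero_iff]
    exact fun h => hn (Zsqrtd.ext_iff.2 h)
  simp only [natCast_dvd_iff]
  have hdiv : {d ∈ Finset.Icc 1 K | d ∣ Int.gcd n.re n.im} = (Int.gcd n.re n.im).divisors := by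
    ext d
    simp only [Finset.mem_filter, Finset.mem_Icc, Nat.mem_divisors]
    constructor
    · exact fun h => ⟨h.2, h0⟩
    · exact fun h => ⟨⟨Nat.pos_of_dvd_of_pos h.1 (Nat.pos_of_ne_zero h0),
        (Nat.le_of_dvd (Nat.pos_of_ne_zero h0) h.1).trans hK⟩, h.1⟩
  rw [← Finset.sum_filter, hdiv]
  have h := DFunLike.congr_fun (coe_moebius_mul_coe_zeta (R := ℂ)) (Int.gcd n.re n.im)
  rw [coe_mul_zeta_apply, one_apply] at h
  simp only [intCoe_apply] at h
  simp only [h, ← Nat.ne_one_iff_exists_prime_dvd, ite_not]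

theorem finite_norm_le (R : ℝ) : {n : GaussianInt | (n.norm : ℝ) ≤ R}.Finite := by
  obtain ⟨M, hM⟩ := exists_nat_ge R
  refine Set.Finite.subset (((Finset.Icc (-M : ℤ) M) ×ˢ (Finset.Icc (-M : ℤ) M)).image
    fun p => (⟨p.1, p.2⟩ : GaussianInt)).finite_toSet fun n hn => ?_
  have h : n.norm ≤ M := by
    have : (n.norm : ℝ) ≤ M := le_trans hn hM
    exact_mod_cast this
  rw [norm_def'] at h
  simp only [Finset.coe_image, Set.mem_image, Finset.mem_coe, Finset.mem_product, Finset.mem_Icc]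
  refine ⟨(n.re, n.im), ⟨⟨?_, ?_⟩, ?_, ?_⟩, rfl⟩ <;> nlinarith [sq_nonneg n.re, sq_nonneg n.im]

theorem HsumTerm_eq_zero {w : ℝ → ℝ} {B : ℝ} (hB : ∀ t, w t ≠ 0 → t ≤ B) (l : GaussianInt) {X : ℝ}
    (hX : 0 < X) {n : GaussianInt} (hn : B * X < n.norm) : HsumTerm w l X n = 0 := by
  have : w (n.norm / X) = 0 := by
    by_contra h
    have := hB _ h
    rw [div_le_iff₀ hX] at this
    linarith
  rw [HsumTerm, this]
  simp

theorem HsumTerm_eq_zero_of_not_squarefree (w : ℝ → ℝ) (l : GaussianInt) (X : ℝ) {n : GaussianInt}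
    (hn : ¬Squarefree n) : HsumTerm w l X n = 0 := by
  rw [HsumTerm]
  split_ifs with h
  · rw [quarticGaussSum_eq_zero h.odd hn]
    simp
  · rfl

theorem finsum_HsumTerm_dvd (w : ℝ → ℝ) (l : GaussianInt) (Q : ℝ) {d : ℕ} (hd : Odd d) :
    ∑ᶠ n, (if (d : GaussianInt) ∣ n then HsumTerm w l Q n else 0) =
      conj (GaussianInt.toComplex (quarticSymbol l (primaryNat d))) *
          quarticGaussSum (primaryNat d) / d *
        Hsum w (l * (d : GaussianInt) ^ 2) (Q / (d : ℝ) ^ 2) := by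
  have hinj : Function.Injective fun m => primaryNat d * m :=
    mul_right_injective₀ (isPrimary_primaryNat hd).ne_zero
  have hr : ∀ n, n ∈ Set.range (fun m => primaryNat d * m) ↔ (d : GaussianInt) ∣ n := by
    intro n
    rw [← (primaryNat_associated d).dvd_iff_dvd_left]
    exact ⟨fun ⟨m, hm⟩ => ⟨m, hm.symm⟩, fun ⟨m, hm⟩ => ⟨m, hm.symm⟩⟩
  have h := finsum_mem_range (f := HsumTerm w l Q) hinj
  simp only [hr, HsumTerm_primaryNat_mul w l Q hd, finsum_eq_if] at h
  rw [Hsum_eq, ← smul_eq_mul, smul_finsum]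
  simp only [h, smul_eq_mul]

theorem HsumTerm_eq_zero_of_even_dvd (w : ℝ → ℝ) (l : GaussianInt) (X : ℝ) {d : ℕ}
    (hd : ¬Odd d) {n : GaussianInt} (hdn : (d : GaussianInt) ∣ n) : HsumTerm w l X n = 0 := by
  rw [HsumTerm, if_neg]
  intro h
  have h1 := odd_norm_of_dvd hdn h.odd
  rw [Zsqrtd.norm_natCast, Int.odd_mul] at h1
  exact hd (by exact_mod_cast h1.1)

open ArithmeticFunction in
theorem norm_Hsum'_le {w : ℝ → ℝ} {B : ℝ} (hB : ∀ t, w t ≠ 0 → t ≤ B) (l : GaussianInt) {Q : ℝ}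
    (hQ : 0 < Q) :
    ∃ s : Finset ℕ, (∀ d ∈ s, Odd d) ∧
      ‖Hsum' w l Q‖ ≤ ∑ d ∈ s, ‖Hsum w (l * (d : GaussianInt) ^ 2) (Q / (d : ℝ) ^ 2)‖ := by
  set S := (finite_norm_le (B * Q)).toFinset with hS
  have hmem : ∀ n, n ∉ S → HsumTerm w l Q n = 0 := fun n hn =>
    HsumTerm_eq_zero hB l hQ (by simpa [hS] using hn)
  set K := S.sup fun n => Int.gcd n.re n.im with hK
  have h1 : Hsum' w l Q =
      ∑ n ∈ S, ∑ d ∈ Finset.Icc 1 K,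
        (moebius d : ℂ) * if (d : GaussianInt) ∣ n then HsumTerm w l Q n else 0 := by
    have key : ∀ n, (if IsPrimary n ∧ Squarefree n ∧ ¬∃ p : ℕ, p.Prime ∧ (p : GaussianInt) ∣ n then
        conj (GaussianInt.toComplex (quarticSymbol l n)) * quarticGaussSum n /
          (Real.sqrt ((Zsqrtd.norm n : ℝ)) : ℂ) * ((w ((Zsqrtd.norm n : ℝ) / Q)) : ℂ)
        else 0) =
        (if ∃ p : ℕ, p.Prime ∧ (p : GaussianInt) ∣ n then 0 else 1) * HsumTerm w l Q n := by
      intro n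
      by_cases hsq : Squarefree n
      · rw [HsumTerm]
        by_cases hp : ∃ p : ℕ, p.Prime ∧ (p : GaussianInt) ∣ n <;> simp [hsq, hp]
      · rw [HsumTerm_eq_zero_of_not_squarefree w l Q hsq]
        simp [hsq]
    rw [Hsum', finsum_congr key, finsum_eq_sum_of_support_subset (s := S)]
    · refine Finset.sum_congr rfl fun n hn => ?_
      by_cases h0 : n = 0
      · subst h0
        simp [HsumTerm_eq_zero_of_not_squarefree w l Q not_squarefree_zero]
      · rw [← sum_moebius_natCast_dvd h0 (Finset.le_sup (f := fun n => Int.gcd n.re n.im) hn),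
          Finset.sum_mul]
        refine Finset.sum_congr rfl fun d _ => ?_
        split_ifs <;> simp
    · intro n hn
      by_contra h
      exact hn (by simp [hmem n h])
  have h2 : ∀ d : ℕ, ∑ n ∈ S, (if (d : GaussianInt) ∣ n then HsumTerm w l Q n else 0) =
      ∑ᶠ n, (if (d : GaussianInt) ∣ n then HsumTerm w l Q n else 0) := by
    intro d
    rw [finsum_eq_sum_of_support_subset]
    intro n hn
    by_contra h
    exact hn (by simp [hmem n h])
  refine ⟨{d ∈ Finset.Icc 1 K | Odd d}, fun d hd => (Finset.mem_filter.1 hd).2, ?_⟩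
  rw [h1, Finset.sum_comm, Finset.sum_filter]
  refine (norm_sum_le _ _).trans (Finset.sum_le_sum fun d hd => ?_)
  have hd0 : (0 : ℝ) < d := by exact_mod_cast (Finset.mem_Icc.1 hd).1
  have hmu : ‖((moebius d : ℤ) : ℂ)‖ ≤ 1 := by
    rw [Complex.norm_intCast]
    exact_mod_cast abs_moebius_le_one
  rw [← Finset.mul_sum, h2, norm_mul]
  split_ifs with ho
  · have hg := norm_quarticGaussSum_le (isPrimary_primaryNat ho).odd
    rw [norm_primaryNat] at hg
    push_cast at hg
    rw [Real.sqrt_sq hd0.le] at hg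
    rw [finsum_HsumTerm_dvd w l Q ho, norm_mul, norm_div, norm_mul, RCLike.norm_conj,
      Complex.norm_natCast]
    have hs := norm_quarticSymbol_le (isPrimary_primaryNat ho).odd l
    have h3 : ‖GaussianInt.toComplex (quarticSymbol l (primaryNat d))‖ *
        ‖quarticGaussSum (primaryNat d)‖ / d ≤ 1 := by
      rw [div_le_one hd0]
      exact (mul_le_of_le_one_left (_root_.norm_nonneg _) hs).trans hg
    exact (mul_le_of_le_one_left (by positivity) hmu).trans
      (mul_le_of_le_one_left (by positivity) h3)
  · rw [finsum_eq_zero_of_forall_eq_zero, norm_zero, mul_zero]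
    intro n
    split_ifs with h
    · exact HsumTerm_eq_zero_of_even_dvd w l Q ho h
    · rfl

theorem exists_primary_decomposition {l : GaussianInt} (hl : l ≠ 0) :
    ∃ l₀ l₁ : GaussianInt, l = l₀ * l₁ ∧
      (∃ (u : GaussianInt) (k : ℕ), IsUnit u ∧ l₀ = u * (⟨1, 1⟩ : GaussianInt) ^ k) ∧
      IsPrimary l₁ := by
  have hirr : Irreducible (⟨1, 1⟩ : GaussianInt) :=
    (prime_of_norm_eq_prime Nat.prime_two (by simp [norm_def'])).irreducible
  obtain ⟨k, m, hm, rfl⟩ := WfDvdMonoid.max_power_factor hl hirr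
  have ho : Odd m.norm := by
    rw [odd_norm_iff, ← Int.not_even_iff_odd]
    rintro ⟨c, hc⟩
    refine hm ⟨⟨c, m.im - c⟩, ?_⟩
    rw [Zsqrtd.ext_iff]
    constructor
    · simp
      linarith
    · simp
  obtain ⟨u, hu, hp⟩ := exists_isPrimary_mul_unit ho
  obtain ⟨v, hv⟩ := hu.exists_left_inv
  exact ⟨v * ⟨1, 1⟩ ^ k, u * m, by linear_combination (-⟨1, 1⟩ ^ k * m) * hv,
    ⟨v, k, IsUnit.of_mul_eq_one u hv, rfl⟩, hp⟩

theorem IsPrimary.one_le_norm {n : GaussianInt} (hn : IsPrimary n) : (1 : ℝ) ≤ n.norm := by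
  exact_mod_cast Int.add_one_le_iff.2 (GaussianInt.norm_pos.2 hn.ne_zero)

theorem norm_HsumTerm_le {w : ℝ → ℝ} {M : ℝ} (hM : ∀ t, |w t| ≤ M) (l : GaussianInt) (X : ℝ)
    (n : GaussianInt) : ‖HsumTerm w l X n‖ ≤ M := by
  have hM0 : 0 ≤ M := (abs_nonneg _).trans (hM 0)
  rw [HsumTerm]
  split_ifs with hn
  · rw [norm_mul, norm_div, norm_mul, RCLike.norm_conj, Complex.norm_real, Complex.norm_real,
      Real.norm_eq_abs, Real.norm_eq_abs, abs_of_nonneg (Real.sqrt_nonneg _)]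
    have h1 := norm_quarticSymbol_le hn.odd l
    have h2 := norm_quarticGaussSum_le hn.odd
    have h3 : 0 < Real.sqrt n.norm := Real.sqrt_pos.2 (zero_lt_one.trans_le hn.one_le_norm)
    refine (mul_le_of_le_one_left (abs_nonneg _) ?_).trans (hM _)
    rw [div_le_one h3]
    exact (mul_le_of_le_one_left (_root_.norm_nonneg _) h1).trans h2
  · simpa using hM0

theorem Hsum_eq_zero {w : ℝ → ℝ} {B : ℝ} (hB : ∀ t, w t ≠ 0 → t ≤ B) (l : GaussianInt) {X : ℝ}
    (hX : 0 < X) (hBX : B * X < 1) : Hsum w l X = 0 := by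
  rw [Hsum_eq]
  refine finsum_eq_zero_of_forall_eq_zero fun n => ?_
  by_cases hn : IsPrimary n
  · exact HsumTerm_eq_zero hB l hX (hBX.trans_le hn.one_le_norm)
  · rw [HsumTerm, if_neg hn]

theorem exists_Hsum_le_mul {w : ℝ → ℝ} {B M : ℝ} (hB0 : 0 < B) (hB : ∀ t, w t ≠ 0 → t ≤ B)
    (hM : ∀ t, |w t| ≤ M)
    (htriv : ∃ C : ℝ, ∀ (l : GaussianInt) (X : ℝ), 1 ≤ X → ‖Hsum w l X‖ ≤ C * X) :
    ∃ C : ℝ, 0 ≤ C ∧ ∀ (l : GaussianInt) (X : ℝ), 0 < X → ‖Hsum w l X‖ ≤ C * X := by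
  obtain ⟨C, hC⟩ := htriv
  have hM0 : 0 ≤ M := (abs_nonneg _).trans (hM 0)
  set S := (finite_norm_le B).toFinset with hS
  refine ⟨max C (S.card * M * B), le_max_of_le_right (by positivity), fun l X hX => ?_⟩
  rcases le_or_gt 1 X with h1 | h1
  · exact (hC l X h1).trans (mul_le_mul_of_nonneg_right (le_max_left _ _) hX.le)
  rcases lt_or_ge (B * X) 1 with h2 | h2
  · rw [Hsum_eq_zero hB l hX h2, norm_zero]
    exact mul_nonneg (le_max_of_le_right (by positivity)) hX.le
  · have hs : Hsum w l X = ∑ n ∈ S, HsumTerm w l X n := by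
      rw [Hsum_eq, finsum_eq_sum_of_support_subset]
      intro n hn
      by_contra h
      refine hn (HsumTerm_eq_zero hB l hX ?_)
      have h3 : B < n.norm := by simpa [hS] using h
      exact (mul_le_of_le_one_right hB0.le h1.le).trans_lt h3
    calc ‖Hsum w l X‖ ≤ ∑ n ∈ S, ‖HsumTerm w l X n‖ := hs ▸ norm_sum_le _ _
      _ ≤ S.card * M := by
        rw [← nsmul_eq_mul]
        exact Finset.sum_le_card_nsmul _ _ _ fun n _ => norm_HsumTerm_le hM l X n
      _ ≤ S.card * M * (B * X) := le_mul_of_one_le_right (by positivity) h2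
      _ = S.card * M * B * X := by ring
      _ ≤ _ := mul_le_mul_of_nonneg_right (le_max_right _ _) hX.le

theorem le_of_le_mul_of_le_mul_add {h C X a b s : ℝ} (hC : 0 ≤ C) (hX : 0 < X) (hs : 0 ≤ s)
    (hb : 0 ≤ b) (h1 : h ≤ C * X) (h2 : h ≤ C * (a + b)) (hsq : a * X = s ^ 2) :
    h ≤ C * (s + b) := by
  rcases le_or_gt X s with hXs | hXs
  · exact h1.trans (mul_le_mul_of_nonneg_left (by linarith) hC)
  · have : a ≤ s := le_of_mul_le_mul_right (by nlinarith) hX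
    exact h2.trans (mul_le_mul_of_nonneg_left (by linarith) hC)

theorem le_rpow_of_min_bound {h C Q d N B δ : ℝ} (hC : 0 ≤ C) (hδ : 0 < δ) (hQ : 1 ≤ Q)
    (hd : 0 < d) (hN : 1 ≤ N) (hB : 1 ≤ B) (hdQ : d ^ 2 ≤ B * Q) (h1 : h ≤ C * (Q / d ^ 2))
    (h2 : h ≤ C * ((Q / d ^ 2) ^ ((1 : ℝ) / 2 + δ) * (N * d ^ 4) ^ ((1 : ℝ) / 4) +
      (Q / d ^ 2) ^ ((3 : ℝ) / 4) * (N * d ^ 4) ^ ((1 : ℝ) / 8 + δ))) :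
    h ≤ C * (2 * B ^ (5 * δ)) * Q ^ ((3 : ℝ) / 4 + 5 * δ) * N ^ ((1 : ℝ) / 8 + 5 * δ) *
      d ^ (-1 - δ) := by
  obtain ⟨x, rfl⟩ : ∃ x, Real.exp x = Q := ⟨_, Real.exp_log (by linarith)⟩
  obtain ⟨y, rfl⟩ : ∃ x, Real.exp x = d := ⟨_, Real.exp_log hd⟩
  obtain ⟨z, rfl⟩ : ∃ x, Real.exp x = N := ⟨_, Real.exp_log (by linarith)⟩
  obtain ⟨b, rfl⟩ : ∃ x, Real.exp x = B := ⟨_, Real.exp_log (by linarith)⟩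
  rw [Real.one_le_exp_iff] at hQ hN hB
  rw [← Real.exp_nat_mul, ← Real.exp_add, Real.exp_le_exp] at hdQ
  simp only [← Real.exp_nat_mul, ← Real.exp_sub, ← Real.exp_add, ← Real.exp_mul] at h1 h2 ⊢
  push_cast at *
  have h3 := le_of_le_mul_of_le_mul_add (s := Real.exp ((3 / 4 + δ / 2) * (x - 2 * y) +
    (z + 4 * y) / 8)) hC (Real.exp_pos _) (Real.exp_pos _).le (Real.exp_pos _).le h1 h2 (by
      rw [← Real.exp_add, ← Real.exp_nat_mul]
      congr 1
      push_cast
      ring)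
  set E := b * (5 * δ) + x * (3 / 4 + 5 * δ) + z * (1 / 8 + 5 * δ) + y * (-1 - δ) with hE
  have hx := mul_nonneg hδ.le hQ
  have hz := mul_nonneg hδ.le hN
  have hb := mul_nonneg hδ.le hB
  have hy := mul_le_mul_of_nonneg_left hdQ hδ.le
  have h4 : Real.exp ((3 / 4 + δ / 2) * (x - 2 * y) + (z + 4 * y) / 8) ≤ Real.exp E := by
    rw [Real.exp_le_exp]
    nlinarith
  have h5 : Real.exp ((x - 2 * y) * (3 / 4) + (z + 4 * y) * (1 / 8 + δ)) ≤ Real.exp E := by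
    rw [Real.exp_le_exp]
    nlinarith
  calc h ≤ C * (Real.exp E + Real.exp E) :=
        h3.trans (mul_le_mul_of_nonneg_left (add_le_add h4 h5) hC)
    _ = _ := by
      rw [hE, Real.exp_add, Real.exp_add, Real.exp_add]
      ring
/-- assuming the bound
`H(l,X) ≪ X^{1/2+ε} N(l₁)^{1/4} + X^{3/4} N(l₁)^{1/8+ε}` (where `l = l₀l₁` with `l₀` a unit
times a power of `1+i` and `l₁` primary) and the trivial bound `H(l,X) ≪ X`, the sieved sum
satisfies `H′(l,Q) ≪ Q^{3/4+ε} N(l)^{1/8+ε}`. -/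
theorem Hsum'_bound (w : ℝ → ℝ) (hw : ContDiff ℝ (⊤ : ℕ∞) w) (hwc : HasCompactSupport w)
    (hwsupp : tsupport w ⊆ Set.Ioi 0)
    (hH : ∀ ε : ℝ, 0 < ε → ∃ C : ℝ, ∀ l l₀ l₁ : GaussianInt, l = l₀ * l₁ →
      (∃ (u : GaussianInt) (k : ℕ), IsUnit u ∧ l₀ = u * (⟨1, 1⟩ : GaussianInt) ^ k) →
      IsPrimary l₁ → ∀ X : ℝ, 1 ≤ X →
        ‖Hsum w l X‖ ≤
          C * (X ^ ((1 : ℝ) / 2 + ε) * ((Zsqrtd.norm l₁ : ℝ)) ^ ((1 : ℝ) / 4) +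
            X ^ ((3 : ℝ) / 4) * ((Zsqrtd.norm l₁ : ℝ)) ^ ((1 : ℝ) / 8 + ε)))
    (htriv : ∃ C : ℝ, ∀ (l : GaussianInt) (X : ℝ), 1 ≤ X → ‖Hsum w l X‖ ≤ C * X) :
    ∀ ε : ℝ, 0 < ε → ∃ C : ℝ, ∀ l : GaussianInt, l ≠ 0 → ∀ Q : ℝ, 1 ≤ Q →
      ‖Hsum' w l Q‖ ≤ C * Q ^ ((3 : ℝ) / 4 + ε) * ((Zsqrtd.norm l : ℝ)) ^ ((1 : ℝ) / 8 + ε) := by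
  intro ε hε
  obtain ⟨B, hB1, hB⟩ : ∃ B : ℝ, 1 ≤ B ∧ ∀ t, w t ≠ 0 → t ≤ B := by
    obtain ⟨b, hb⟩ := hwc.isCompact.bddAbove
    exact ⟨max 1 b, le_max_left _ _, fun t ht =>
      (hb (subset_tsupport w (Function.mem_support.2 ht))).trans (le_max_right _ _)⟩
  obtain ⟨M, hM⟩ := hw.continuous.bounded_above_of_compact_support hwc
  obtain ⟨C₁, hC₁0, hC₁⟩ := exists_Hsum_le_mul (zero_lt_one.trans_le hB1) hB hM htriv
  set δ := ε / 5 with hδ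
  have hδ0 : 0 < δ := by positivity
  have hεδ : ε = 5 * δ := by rw [hδ]; ring
  obtain ⟨C₂, hC₂⟩ := hH δ hδ0
  set C := max C₁ C₂ with hC
  have hC0 : 0 ≤ C := hC₁0.trans (le_max_left _ _)
  have hall : ∀ l l₀ l₁ : GaussianInt, l = l₀ * l₁ →
      (∃ (u : GaussianInt) (k : ℕ), IsUnit u ∧ l₀ = u * (⟨1, 1⟩ : GaussianInt) ^ k) →
      IsPrimary l₁ → ∀ X : ℝ, 0 < X →
        ‖Hsum w l X‖ ≤
          C * (X ^ ((1 : ℝ) / 2 + δ) * ((Zsqrtd.norm l₁ : ℝ)) ^ ((1 : ℝ) / 4) +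
            X ^ ((3 : ℝ) / 4) * ((Zsqrtd.norm l₁ : ℝ)) ^ ((1 : ℝ) / 8 + δ)) := by
    intro l l₀ l₁ h h₀ h₁ X hX
    have hN := h₁.one_le_norm
    have hN0 := zero_le_one.trans hN
    rcases le_or_gt 1 X with hX1 | hX1
    · exact (hC₂ l l₀ l₁ h h₀ h₁ X hX1).trans
        (mul_le_mul_of_nonneg_right (le_max_right _ _) (by positivity))
    · refine (hC₁ l X hX).trans (mul_le_mul (le_max_left _ _) ?_ hX.le hC0)
      have h1 : X ≤ X ^ ((3 : ℝ) / 4) := by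
        simpa using Real.rpow_le_rpow_of_exponent_ge hX hX1.le
          (show (3 : ℝ) / 4 ≤ 1 by norm_num)
      have h2 : 1 ≤ ((Zsqrtd.norm l₁ : ℝ)) ^ ((1 : ℝ) / 8 + δ) :=
        Real.one_le_rpow hN (by positivity)
      exact h1.trans ((le_mul_of_one_le_right (by positivity) h2).trans
        (le_add_of_nonneg_left (by positivity)))
  have hsum : Summable fun d : ℕ => (d : ℝ) ^ (-1 - δ) :=
    Real.summable_nat_rpow.2 (by linarith)
  set D := C * (2 * B ^ (5 * δ)) with hD
  have hD0 : 0 ≤ D := by positivity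
  refine ⟨D * ∑' d : ℕ, (d : ℝ) ^ (-1 - δ), fun l hl Q hQ => ?_⟩
  have hQ0 : 0 < Q := zero_lt_one.trans_le hQ
  obtain ⟨l₀, l₁, hll, h₀, h₁⟩ := exists_primary_decomposition hl
  have hN1 := h₁.one_le_norm
  have hNl : (l₁.norm : ℝ) ≤ l.norm := by
    exact_mod_cast Int.le_of_dvd (GaussianInt.norm_pos.2 hl)
      (norm_dvd_norm (hll ▸ dvd_mul_left l₁ l₀))
  have hN0 : (0 : ℝ) ≤ l.norm := by linarith
  have hd : ∀ d : ℕ, Odd d → ‖Hsum w (l * (d : GaussianInt) ^ 2) (Q / (d : ℝ) ^ 2)‖ ≤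
      D * Q ^ ((3 : ℝ) / 4 + ε) * ((Zsqrtd.norm l : ℝ)) ^ ((1 : ℝ) / 8 + ε) *
        (d : ℝ) ^ (-1 - δ) := by
    intro d hdo
    have hd0 : (0 : ℝ) < d := by exact_mod_cast hdo.pos
    have hX : 0 < Q / (d : ℝ) ^ 2 := by positivity
    rcases lt_or_ge (B * (Q / (d : ℝ) ^ 2)) 1 with h1 | h1
    · rw [Hsum_eq_zero hB _ hX h1, norm_zero]
      positivity
    have hdQ : (d : ℝ) ^ 2 ≤ B * Q := by
      rwa [← mul_div_assoc, le_div_iff₀ (by positivity), one_mul] at h1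
    have hnorm : (((l₁ * (d : GaussianInt) ^ 2).norm : ℤ) : ℝ) = l₁.norm * (d : ℝ) ^ 4 := by
      rw [pow_two, Zsqrtd.norm_mul, Zsqrtd.norm_mul, Zsqrtd.norm_natCast]
      push_cast
      ring
    have hp : IsPrimary (l₁ * (d : GaussianInt) ^ 2) := by
      rw [natCast_sq_eq]
      exact h₁.mul ((isPrimary_primaryNat hdo).mul (isPrimary_primaryNat hdo))
    have h2 := hall (l * (d : GaussianInt) ^ 2) l₀ (l₁ * (d : GaussianInt) ^ 2)
      (by rw [hll, mul_assoc]) h₀ hp _ hX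
    rw [hnorm] at h2
    have h3 : ‖Hsum w (l * (d : GaussianInt) ^ 2) (Q / (d : ℝ) ^ 2)‖ ≤ C * (Q / (d : ℝ) ^ 2) :=
      (hC₁ _ _ hX).trans (mul_le_mul_of_nonneg_right (le_max_left _ _) hX.le)
    refine (le_rpow_of_min_bound hC0 hδ0 hQ hd0 hN1 hB1 hdQ h3 h2).trans ?_
    rw [← hεδ]
    gcongr
    exact (by rw [hD, ← hεδ] : C * (2 * B ^ ε) = D).le
  obtain ⟨s, hs, hle⟩ := norm_Hsum'_le hB l hQ0
  calc ‖Hsum' w l Q‖ ≤ ∑ d ∈ s, D * Q ^ ((3 : ℝ) / 4 + ε) *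
        ((Zsqrtd.norm l : ℝ)) ^ ((1 : ℝ) / 8 + ε) * (d : ℝ) ^ (-1 - δ) :=
        hle.trans (Finset.sum_le_sum fun d hds => hd d (hs d hds))
    _ ≤ D * Q ^ ((3 : ℝ) / 4 + ε) * ((Zsqrtd.norm l : ℝ)) ^ ((1 : ℝ) / 8 + ε) *
        ∑' d : ℕ, (d : ℝ) ^ (-1 - δ) := by
      rw [← Finset.mul_sum]
      exact mul_le_mul_of_nonneg_left
        (hsum.sum_le_tsum _ fun d _ => by positivity) (by positivity)
    _ = _ := by ring
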